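/- arXiv:1810.03144 — 5 statements merged into one kernel-verified Lean document; each statement's English description precedes it below -/
import Mathlib

section
/- Let 0 < α < 2 and β ∈ ℝ. Then there exists a constant C > 0 (depending only on α and β) such that for all t ≥ 0, |E_{α,β}(−t)| ≤ C / (1 + t). -/
/-- The Mittag--Leffler function `E_{α,β}(z) = ∑_{k=0}^∞ z^k / Γ(kα + β)`. -/
noncomputable def mittagLeffler (α β z : ℝ) : ℝ :=
  ∑' k : ℕ, z ^ k / Real.Gamma (k * α + β)

open MeasureTheory Set Filter Topology

lemma ml_int (s b : ℝ) (hs : -1 < s) (hb : 0 < b) :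
    IntegrableOn (fun u : ℝ => u ^ s * Real.exp (-(b * u))) (Ioi 0) := by
  have := integrableOn_rpow_mul_exp_neg_mul_rpow (p := 1) (s := s) (b := b) hs one_pos hb
  simpa [Real.rpow_one] using this

lemma ml_norm (s : ℝ) (w : ℂ) (u : ℝ) (hu : 0 < u) :
    ‖((u ^ s : ℝ) : ℂ) * Complex.exp (-(w * u))‖ = u ^ s * Real.exp (-(w.re * u)) := by
  rw [norm_mul, Complex.norm_exp, Complex.norm_real, Real.norm_of_nonneg (by positivity)]
  simp

lemma ml_meas (s : ℝ) (w : ℂ) : Measurable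
    (fun u : ℝ => ((u ^ s : ℝ) : ℂ) * Complex.exp (-(w * u))) := by
  fun_prop

lemma ml_intC (s : ℝ) (hs : -1 < s) (w : ℂ) (hw : 0 < w.re) :
    IntegrableOn (fun u : ℝ => ((u ^ s : ℝ) : ℂ) * Complex.exp (-(w * u))) (Ioi 0) := by
  refine Integrable.mono' (ml_int s w.re hs hw) (ml_meas s w).aestronglyMeasurable ?_
  filter_upwards [ae_restrict_mem measurableSet_Ioi] with u hu
  rw [ml_norm s w u hu]

lemma ml_laplace (s : ℝ) (hs : 0 < s) (w : ℂ) (hw : 0 < w.re) :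
    ∫ u in Ioi (0:ℝ), ((u ^ (s - 1) : ℝ) : ℂ) * Complex.exp (-(w * u))
      = (Real.Gamma s : ℂ) * w ^ (-(s : ℂ)) := by
  have hU : IsOpen {w : ℂ | 0 < w.re} := isOpen_lt continuous_const Complex.continuous_re
  have hd : DifferentiableOn ℂ (fun w : ℂ =>
      ∫ u in Ioi (0:ℝ), ((u ^ (s - 1) : ℝ) : ℂ) * Complex.exp (-(w * u))) {w : ℂ | 0 < w.re} := by
    intro w₀ hw₀
    have hw₀' : 0 < w₀.re := hw₀
    refine DifferentiableAt.differentiableWithinAt ?_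
    refine (hasDerivAt_integral_of_dominated_loc_of_deriv_le (𝕜 := ℂ)
      (s := Metric.ball w₀ (w₀.re / 2)) (μ := volume.restrict (Ioi (0:ℝ)))
      (F := fun (w : ℂ) (u : ℝ) => ((u ^ (s - 1) : ℝ) : ℂ) * Complex.exp (-(w * u)))
      (F' := fun (w : ℂ) (u : ℝ) => ((u ^ (s - 1) : ℝ) : ℂ) * (Complex.exp (-(w * u)) * (-u)))
      (bound := fun u => u ^ s * Real.exp (-((w₀.re / 2) * u)))
      (Metric.ball_mem_nhds _ (by positivity)) ?_ ?_ ?_ ?_ ?_ ?_).2.differentiableAt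
    · exact Eventually.of_forall fun w => (ml_meas (s-1) w).aestronglyMeasurable
    · exact ml_intC _ (by linarith) _ hw₀
    · refine Measurable.aestronglyMeasurable ?_
      fun_prop
    · filter_upwards [ae_restrict_mem measurableSet_Ioi] with u hu
      intro x hx
      have hu' : 0 < u := hu
      rw [← mul_assoc, norm_mul, ml_norm _ _ _ hu']
      have h1 : w₀.re / 2 ≤ x.re := by
        have h2 : |(x - w₀).re| ≤ ‖x - w₀‖ := Complex.abs_re_le_norm _
        rw [Metric.mem_ball, dist_eq_norm] at hx
        have := abs_le.1 h2
        simp only [Complex.sub_re] at this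
        linarith [this.1]
      rw [norm_neg, Complex.norm_real, Real.norm_of_nonneg hu'.le, mul_right_comm]
      have : u ^ (s-1) * u = u ^ s := by
        rw [← Real.rpow_add_one hu'.ne']; simp
      rw [this]
      gcongr
    · exact ml_int s _ (by linarith) (by positivity)
    · refine Eventually.of_forall fun u x _ => ?_
      have h1 : HasDerivAt (fun x : ℂ => -(x * u)) (-(u:ℂ)) x := by
        simpa using ((hasDerivAt_id x).mul_const (u:ℂ)).fun_neg
      exact (h1.cexp).const_mul _
  have hg : DifferentiableOn ℂ (fun w : ℂ => (Real.Gamma s : ℂ) * w ^ (-(s : ℂ)))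
      {w : ℂ | 0 < w.re} := by
    intro x hx
    refine DifferentiableAt.differentiableWithinAt ?_
    refine DifferentiableAt.const_mul ?_ _
    exact differentiableAt_id.cpow_const (Or.inl hx)
  have hpc : IsPreconnected {w : ℂ | 0 < w.re} := (convex_halfSpace_re_gt 0).isPreconnected
  refine (hd.analyticOnNhd hU).eqOn_of_preconnected_of_frequently_eq (hg.analyticOnNhd hU) hpc
    (z₀ := 1) (by simp) ?_ hw
  have hreal : ∀ r : ℝ, 0 < r →
    ∫ u in Ioi (0:ℝ), ((u ^ (s - 1) : ℝ) : ℂ) * Complex.exp (-((r:ℂ) * u))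
      = (Real.Gamma s : ℂ) * (r:ℂ) ^ (-(s : ℂ)) := by
    intro r hr
    have := Complex.integral_cpow_mul_exp_neg_mul_Ioi (a := s) (r := r) (by simpa) hr
    rw [Complex.Gamma_ofReal] at this
    rw [mul_comm, Complex.cpow_neg, ← Complex.inv_cpow, ← one_div, ← this]
    · refine setIntegral_congr_fun measurableSet_Ioi fun u hu => ?_
      have hu' : 0 < u := hu
      rw [Complex.ofReal_cpow hu'.le]; push_cast; rfl
    · rw [Complex.arg_ofReal_of_nonneg hr.le]; exact Real.pi_pos.ne
  have ht : Tendsto (fun n : ℕ => ((1 + 1 / ((n:ℝ) + 1) : ℝ) : ℂ)) atTop (𝓝[≠] 1) := by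
    rw [tendsto_nhdsWithin_iff]
    constructor
    · have := (tendsto_one_div_add_atTop_nhds_zero_nat (𝕜 := ℝ)).const_add 1
      rw [add_zero] at this
      have h := (Complex.continuous_ofReal.tendsto 1).comp this
      simpa [Function.comp_def] using h
    · refine Eventually.of_forall fun n => ?_
      simp only [mem_compl_iff, mem_singleton_iff]
      norm_cast
      have : 0 < 1 / ((n:ℝ) + 1) := by positivity
      push_cast
      linarith
  exact ht.frequently (Eventually.of_forall fun n => hreal _ (by positivity)).frequently

/-- the point on the vertical line -/
noncomputable def mlw (x : ℝ) : ℂ := 1 + 2 * Real.pi * x * Complex.I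

lemma mlw_re (x : ℝ) : (mlw x).re = 1 := by simp [mlw]
lemma mlw_im (x : ℝ) : (mlw x).im = 2 * Real.pi * x := by simp [mlw]
lemma mlw_cont : Continuous mlw := by unfold mlw; fun_prop
lemma mlw_ne (x : ℝ) : mlw x ≠ 0 := fun h => by
  have := mlw_re x
  rw [h] at this; simp at this
lemma mlw_norm (x : ℝ) : 1 ≤ ‖mlw x‖ := by
  have := Complex.abs_re_le_norm (mlw x)
  rwa [mlw_re, abs_one] at this
lemma mlw_cpow_norm (x s : ℝ) : ‖mlw x ^ (s:ℂ)‖ = ‖mlw x‖ ^ s := by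
  rw [Complex.norm_cpow_of_ne_zero (mlw_ne x)]; simp
lemma mlw_cpow_cont (s : ℂ) : Continuous (fun x => mlw x ^ s) := by
  refine mlw_cont.cpow continuous_const fun x => Or.inl ?_
  rw [mlw_re]; exact one_pos

lemma mlw_integrable (s : ℝ) (hs : 1 < s) : Integrable (fun x => ‖mlw x‖ ^ (-s)) := by
  have h := integrable_rpow_neg_one_add_norm_sq (E := ℝ) (μ := volume) (r := s) (by simpa)
  refine h.mono' ?_ ?_
  · refine Continuous.aestronglyMeasurable ?_
    refine (mlw_cont.norm).rpow_const fun x => Or.inl (norm_ne_zero_iff.2 (mlw_ne x))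
  · refine Eventually.of_forall fun x => ?_
    rw [Real.norm_of_nonneg (by positivity)]
    have h1 : 1 + ‖x‖ ^ 2 ≤ ‖mlw x‖ ^ 2 := by
      rw [← Complex.normSq_eq_norm_sq, Complex.normSq_apply, mlw_re, mlw_im]
      have := Real.pi_gt_three
      have h3 : 1 ≤ (2 * Real.pi)^2 := by nlinarith
      simp only [Real.norm_eq_abs, sq_abs]
      nlinarith [sq_nonneg x]
    have h2 : ‖mlw x‖ ^ (-s) = (‖mlw x‖ ^ 2) ^ (-s / 2) := by
      rw [← Real.rpow_natCast, ← Real.rpow_mul (norm_nonneg _)]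
      congr 1; push_cast; ring
    rw [h2]
    exact Real.rpow_le_rpow_of_nonpos (by positivity) h1 (by linarith)

lemma ml_hankel (s : ℝ) (hs : 1 < s) :
    ∫ x : ℝ, Complex.exp (mlw x) * mlw x ^ (-(s:ℂ)) = ((Real.Gamma s)⁻¹ : ℝ) := by
  set g : ℝ → ℂ := (Ioi (0:ℝ)).indicator
    (fun u => ((u ^ (s - 1) : ℝ) : ℂ) * Complex.exp (-((1:ℂ) * u))) with hg
  have hgi : Integrable g := by
    rw [hg, integrable_indicator_iff measurableSet_Ioi]
    exact ml_intC _ (by linarith) 1 (by simp)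
  have hF : FourierTransform.fourier g =
      fun x => (Real.Gamma s : ℂ) * mlw x ^ (-(s:ℂ)) := by
    funext x
    rw [Real.fourier_real_eq_integral_exp_smul, ← ml_laplace s (by linarith) (mlw x) (by simp [mlw_re]),
      ← integral_indicator measurableSet_Ioi]
    congr 1; funext v
    simp only [hg, Set.indicator]
    split_ifs with hv
    · rw [smul_eq_mul, mul_left_comm, ← Complex.exp_add]
      congr 2
      simp only [mlw]; push_cast; ring
    · simp
  have hFi : Integrable (FourierTransform.fourier g) := by
    rw [hF]
    refine Integrable.const_mul ?_ _
    refine (mlw_integrable s hs).mono' (mlw_cpow_cont _).aestronglyMeasurable ?_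
    refine Eventually.of_forall fun x => ?_
    rw [← Complex.ofReal_neg, mlw_cpow_norm]
  have hc : ContinuousAt g 1 := by
    have : g =ᶠ[𝓝 1] (fun u => ((u ^ (s - 1) : ℝ) : ℂ) * Complex.exp (-((1:ℂ) * u))) := by
      filter_upwards [Ioi_mem_nhds (zero_lt_one (α := ℝ))] with u hu
      simp only [hg]
      rw [Set.indicator_of_mem hu]
    refine ContinuousAt.congr ?_ this.symm
    refine ContinuousAt.mul ?_ (by fun_prop)
    exact Complex.continuous_ofReal.continuousAt.comp
      (continuousAt_id.rpow_const (Or.inl one_ne_zero))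
  have key := hgi.fourierInv_fourier_eq hFi hc
  rw [Real.fourierInv_eq', hF] at key
  have hg1 : g 1 = Complex.exp (-1) := by simp [hg]
  rw [hg1] at key
  have hG : (Real.Gamma s : ℂ) ≠ 0 := by
    exact_mod_cast (Real.Gamma_pos_of_pos (by linarith)).ne'
  have : ∫ x : ℝ, Complex.exp (mlw x) * mlw x ^ (-(s:ℂ)) =
     Complex.exp 1 * (Real.Gamma s : ℂ)⁻¹ * Complex.exp (-1) := by
    rw [← key, ← integral_const_mul]
    congr 1; funext x
    have : Complex.exp (mlw x) = Complex.exp 1 * Complex.exp (((2 * Real.pi * (inner ℝ x 1)  : ℝ):ℂ) * Complex.I) := by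
      rw [← Complex.exp_add]
      congr 1
      simp [mlw]
    rw [this, smul_eq_mul]
    field_simp
  rw [this, mul_right_comm, ← Complex.exp_add]
  simp

lemma ml_Gamma_lower (r s : ℝ) (hr : 0 < r) (hs : 1 ≤ s) :
    r ^ (s - 1) * Real.exp (-r) ≤ Real.Gamma s := by
  have hs0 : 0 < s := by linarith
  rw [Real.Gamma_eq_integral hs0, ← integral_exp_neg_Ioi r, ← integral_const_mul]
  have hi := Real.GammaIntegral_convergent hs0
  have hsub : Ioi r ⊆ Ioi (0:ℝ) := Ioi_subset_Ioi hr.le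
  refine le_trans (setIntegral_mono_on ?_ (hi.mono_set hsub) measurableSet_Ioi ?_)
    (setIntegral_mono_set hi ?_ hsub.eventuallyLE)
  · exact (integrableOn_exp_neg_Ioi r).const_mul _
  · intro x hx
    have hx' : r < x := hx
    rw [mul_comm]
    gcongr
  · filter_upwards [ae_restrict_mem measurableSet_Ioi] with u hu
    have hu' : 0 < u := hu
    simp only [Pi.zero_apply]
    positivity

/-- uniform summable bound -/
lemma ml_bound (α β R : ℝ) (hα : 0 < α) (hβ : 1 < β) (hR : 0 ≤ R) (j : ℕ) :
    ∃ u : ℕ → ℝ, Summable u ∧ ∀ k : ℕ,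
      ((k + j).choose j : ℝ) * R ^ k * (Real.Gamma (k * α + β))⁻¹ ≤ u k := by
  set r : ℝ := (2 * (R + 1)) ^ (1 / α) with hr
  have hr0 : 0 < r := by positivity
  have hrα : r ^ α = 2 * (R + 1) := by
    rw [hr, ← Real.rpow_mul (by positivity), one_div_mul_cancel hα.ne', Real.rpow_one]
  have hq : ‖R / (2 * (R + 1))‖ < 1 := by
    rw [Real.norm_of_nonneg (by positivity), div_lt_one (by positivity)]; linarith
  refine ⟨fun k => (r ^ (β - 1) * Real.exp (-r))⁻¹ *
    (((k + j).choose j : ℝ) * (R / (2 * (R + 1))) ^ k),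
    (summable_choose_mul_geometric_of_norm_lt_one j hq).mul_left _, fun k => ?_⟩
  have h1 := ml_Gamma_lower r (k * α + β) hr0 (by nlinarith [(Nat.cast_nonneg k : (0:ℝ) ≤ k)])
  have h2 : r ^ (k * α + β - 1) = (2 * (R+1)) ^ k * r ^ (β - 1) := by
    rw [show k * α + β - 1 = α * k + (β - 1) by ring, Real.rpow_add hr0, Real.rpow_mul hr0.le, hrα,
      Real.rpow_natCast]
  rw [h2] at h1
  calc _ ≤ ((k + j).choose j : ℝ) * R ^ k *
        ((2 * (R+1)) ^ k * r ^ (β - 1) * Real.exp (-r))⁻¹ := by gcongr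
    _ = _ := by
      simp only [div_pow]; field_simp

/-- the coefficients -/
noncomputable def mlc (α β : ℝ) (j k : ℕ) : ℝ :=
  ((k + j).choose j : ℝ) * (Real.Gamma (k * α + β))⁻¹

lemma mlc_norm (α β : ℝ) (hα : 0 < α) (hβ : 1 < β) (j k : ℕ) (z : ℂ) (R : ℝ) (hz : ‖z‖ ≤ R) :
    ‖(mlc α β j k : ℂ) * (-z) ^ k‖ ≤
      ((k + j).choose j : ℝ) * R ^ k * (Real.Gamma (k * α + β))⁻¹ := by
  have : 0 < Real.Gamma (k * α + β) := Real.Gamma_pos_of_pos (by positivity)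
  rw [norm_mul, norm_pow, norm_neg, Complex.norm_real, mlc, Real.norm_of_nonneg (by positivity),
    mul_right_comm]
  gcongr

lemma mlc_summable (α β : ℝ) (hα : 0 < α) (hβ : 1 < β) (j : ℕ) (z : ℂ) :
    Summable (fun k => (mlc α β j k : ℂ) * (-z) ^ k) := by
  obtain ⟨u, hu, hle⟩ := ml_bound α β ‖z‖ hα hβ (norm_nonneg _) j
  exact Summable.of_norm_bounded hu fun k => (mlc_norm α β hα hβ j k z _ le_rfl).trans (hle k)

lemma mlc_differentiable (α β : ℝ) (hα : 0 < α) (hβ : 1 < β) (j : ℕ) :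
    Differentiable ℂ (fun z => ∑' k, (mlc α β j k : ℂ) * (-z) ^ k) := by
  intro z
  obtain ⟨u, hu, hle⟩ := ml_bound α β (‖z‖ + 1) hα hβ (by positivity) j
  have := Complex.differentiableOn_tsum_of_summable_norm
    (F := fun (k:ℕ) (z:ℂ) => (mlc α β j k : ℂ) * (-z) ^ k) (U := Metric.ball 0 (‖z‖ + 1)) hu
    (fun k => by fun_prop) Metric.isOpen_ball
    (fun k w hw => (mlc_norm α β hα hβ j k w _ (by
      have hw' : ‖w‖ < ‖z‖ + 1 := by simpa using hw
      exact hw'.le)).trans (hle k))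
  exact (this z (by simp)).differentiableAt (Metric.isOpen_ball.mem_nhds (by simp))

lemma ml_sector (α : ℝ) (hα0 : 0 < α) (hα2 : α < 2) (x t : ℝ) (ht : 0 ≤ t) :
    Real.cos (Real.pi * α / 4) * (1 + t * ‖mlw x ^ (-(α:ℂ))‖) ≤
      ‖1 + (t:ℂ) * mlw x ^ (-(α:ℂ))‖ := by
  set θ := (mlw x).arg with hθ
  have hθ2 : |θ| < Real.pi / 2 := by
    rw [hθ, Complex.abs_arg_lt_pi_div_two_iff]; left; rw [mlw_re]; exact one_pos
  have hn : ‖mlw x ^ (-(α:ℂ))‖ = ‖mlw x‖ ^ (-α) := by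
    rw [← Complex.ofReal_neg, mlw_cpow_norm]
  set ρ := ‖mlw x‖ ^ (-α) with hρ
  have hρ0 : 0 ≤ ρ := by positivity
  have hv : mlw x ^ (-(α:ℂ)) = (ρ:ℂ) * Complex.exp (((-(α * θ) : ℝ):ℂ) * Complex.I) := by
    rw [Complex.cpow_def_of_ne_zero (mlw_ne x), hρ,
      Real.rpow_def_of_pos (norm_pos_iff.2 (mlw_ne x)), Complex.ofReal_exp, ← Complex.exp_add]
    congr 1
    rw [Complex.log]
    push_cast
    rw [← hθ]
    ring
  rw [hn, hv]
  set φ := α * θ / 2 with hφ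
  have hmul : Complex.exp ((φ:ℂ) * Complex.I) *
      (1 + (t:ℂ) * ((ρ:ℂ) * Complex.exp (((-(α * θ) : ℝ):ℂ) * Complex.I)))
      = Complex.exp ((φ:ℂ) * Complex.I) +
        ((t * ρ : ℝ) : ℂ) * Complex.exp (((-φ : ℝ):ℂ) * Complex.I) := by
    have : Complex.exp (((-φ : ℝ):ℂ) * Complex.I) = Complex.exp ((φ:ℂ) * Complex.I) *
      Complex.exp (((-(α * θ) : ℝ):ℂ) * Complex.I) := by
      rw [← Complex.exp_add]; congr 1; rw [hφ]; push_cast; ring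
    rw [this]; push_cast; ring
  have hnorm := congrArg norm hmul
  rw [norm_mul, Complex.norm_exp_ofReal_mul_I, one_mul] at hnorm
  rw [hnorm]
  refine le_trans ?_ (Complex.re_le_norm _)
  rw [Complex.add_re, Complex.re_ofReal_mul, Complex.exp_ofReal_mul_I_re,
    Complex.exp_ofReal_mul_I_re, Real.cos_neg]
  have hc : Real.cos (Real.pi * α / 4) ≤ Real.cos φ := by
    rw [← Real.cos_abs φ]
    apply Real.cos_le_cos_of_nonneg_of_le_pi (abs_nonneg _)
    · nlinarith [Real.pi_pos]
    · rw [hφ, abs_div, abs_mul, abs_of_pos hα0, abs_of_pos (zero_lt_two (α := ℝ))]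
      nlinarith
  have : 0 ≤ t * ρ := by positivity
  nlinarith

lemma ml_cpos (α : ℝ) (hα0 : 0 < α) (hα2 : α < 2) : 0 < Real.cos (Real.pi * α / 4) := by
  apply Real.cos_pos_of_mem_Ioo
  constructor <;> nlinarith [Real.pi_pos]

noncomputable def mlh (β x : ℝ) : ℂ := Complex.exp (mlw x) * mlw x ^ (-(β:ℂ))

lemma mlh_cont (β : ℝ) : Continuous (mlh β) :=
  (Complex.continuous_exp.comp mlw_cont).mul (mlw_cpow_cont _)

lemma mlh_norm (β x : ℝ) : ‖mlh β x‖ = Real.exp 1 * ‖mlw x‖ ^ (-β) := by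
  rw [mlh, norm_mul, Complex.norm_exp, mlw_re, ← Complex.ofReal_neg, mlw_cpow_norm]

lemma mlh_integrable (β : ℝ) (hβ : 1 < β) : Integrable (mlh β) := by
  refine ((mlw_integrable β hβ).const_mul (Real.exp 1)).mono' (mlh_cont β).aestronglyMeasurable ?_
  exact Eventually.of_forall fun x => (mlh_norm β x).le

lemma mlv_le (α : ℝ) (hα0 : 0 < α) (x : ℝ) : ‖mlw x ^ (-(α:ℂ))‖ ≤ 1 := by
  rw [← Complex.ofReal_neg, mlw_cpow_norm]
  exact Real.rpow_le_one_of_one_le_of_nonpos (mlw_norm x) (by linarith)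

lemma mlh_pow (α β : ℝ) (k : ℕ) (x : ℝ) :
    mlh β x * (mlw x ^ (-(α:ℂ))) ^ k = mlh (k * α + β) x := by
  rw [mlh, mlh, mul_assoc, ← Complex.cpow_nat_mul, ← Complex.cpow_add _ _ (mlw_ne x)]
  congr 2; push_cast; ring

lemma ml_near_zero (α β : ℝ) (hα0 : 0 < α) (hβ : 1 < β) (j : ℕ) (z : ℂ) (hz : ‖z‖ < 1) :
    ∫ x, mlh β x * (1 / (1 + z * mlw x ^ (-(α:ℂ))) ^ (j + 1)) =
      ∑' k, (mlc α β j k : ℂ) * (-z) ^ k := by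
  have hgeo : ∀ x, HasSum (fun k : ℕ => mlh β x * (((k + j).choose j : ℂ) *
      (-(z * mlw x ^ (-(α:ℂ)))) ^ k)) (mlh β x * (1 / (1 + z * mlw x ^ (-(α:ℂ))) ^ (j + 1))) := by
    intro x
    have : ‖-(z * mlw x ^ (-(α:ℂ)))‖ < 1 := by
      rw [norm_neg, norm_mul]
      have := mlv_le α hα0 x
      nlinarith [norm_nonneg z, norm_nonneg (mlw x ^ (-(α:ℂ)))]
    have h := (hasSum_choose_mul_geometric_of_norm_lt_one j this).mul_left (mlh β x)
    rwa [sub_neg_eq_add] at h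
  have hF : ∀ (k : ℕ) x, mlh β x * (((k + j).choose j : ℂ) * (-(z * mlw x ^ (-(α:ℂ)))) ^ k)
      = (((k + j).choose j : ℂ) * (-z) ^ k) * mlh (k * α + β) x := by
    intro k x
    rw [← mlh_pow, ← neg_mul, mul_pow]; ring
  have hpos : ∀ k : ℕ, 1 < k * α + β := fun k => by
    have : 0 ≤ (k:ℝ) * α := by positivity
    linarith
  have hs := hasSum_integral_of_summable_integral_norm (μ := (volume : Measure ℝ))
    (F := fun (k : ℕ) x => mlh β x * (((k + j).choose j : ℂ) * (-(z * mlw x ^ (-(α:ℂ)))) ^ k))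
    (fun k => by
      simp_rw [hF k]
      exact (mlh_integrable _ (hpos k)).const_mul _) (by
      have hz' : ‖(‖z‖)‖ < 1 := by simpa using hz
      refine Summable.of_nonneg_of_le (fun k => by positivity) (fun k => ?_)
        ((summable_choose_mul_geometric_of_norm_lt_one j hz').mul_right (∫ x, ‖mlh β x‖))
      rw [← integral_const_mul]
      refine integral_mono_of_nonneg (Eventually.of_forall fun x => by positivity)
        ((mlh_integrable β hβ).norm.const_mul _) (Eventually.of_forall fun x => ?_)
      simp only [norm_mul, norm_pow, norm_neg, Complex.norm_natCast]
      rw [mul_comm]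
      have h1 : (‖z‖ * ‖mlw x ^ (-(α:ℂ))‖) ^ k ≤ ‖z‖ ^ k := by
        gcongr
        have := mlv_le α hα0 x
        nlinarith [norm_nonneg z]
      gcongr)
  simp_rw [fun x => (hgeo x).tsum_eq] at hs
  rw [← hs.tsum_eq]
  congr 1; funext k
  simp_rw [hF k]
  rw [integral_const_mul, mlc]
  have := ml_hankel (k * α + β) (hpos k)
  simp only [mlh]
  rw [this]
  push_cast; ring

lemma ml_rep (α β : ℝ) (hα0 : 0 < α) (hα2 : α < 2) (hβ : 1 < β) (j : ℕ) (t : ℝ) (ht : 0 ≤ t) :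
    ∫ x, mlh β x * (1 / (1 + (t:ℂ) * mlw x ^ (-(α:ℂ))) ^ (j + 1)) =
      ∑' k, (mlc α β j k : ℂ) * (-(t:ℂ)) ^ k := by
  set c := Real.cos (Real.pi * α / 4) with hc
  have hc0 : 0 < c := ml_cpos α hα0 hα2
  set P : Set ℂ := {z : ℂ | 0 ≤ z.re ∧ z.im = 0} with hP
  have hPc : Convex ℝ P := by
    intro a ha b hb p q hp hq _
    simp only [hP, mem_ofPred_eq] at ha hb ⊢
    simp only [Complex.add_re, Complex.add_im, Complex.real_smul, Complex.re_ofReal_mul,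
      Complex.im_ofReal_mul, ha.2, hb.2]
    refine ⟨?_, by simp⟩
    have := mul_nonneg hp ha.1
    have := mul_nonneg hq hb.1
    linarith
  set U := Metric.thickening (c / 2) P with hU
  have hUo : IsOpen U := Metric.isOpen_thickening
  have hPt : ∀ s : ℝ, 0 ≤ s → (s:ℂ) ∈ P := fun s hs => by simp [hP, hs]
  have hPU : P ⊆ U := Metric.self_subset_thickening (by positivity) P
  have hlow : ∀ z ∈ U, ∀ x, c / 2 ≤ ‖1 + z * mlw x ^ (-(α:ℂ))‖ := by
    intro z hz x
    obtain ⟨s, hs, hzs⟩ := Metric.mem_thickening_iff.1 hz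
    have hs' : s = ((s.re : ℝ) : ℂ) := by
      apply Complex.ext <;> simp [hs.2]
    have h1 := ml_sector α hα0 hα2 x s.re hs.1
    rw [← hs', ← hc] at h1
    have h2 : c ≤ ‖1 + s * mlw x ^ (-(α:ℂ))‖ := by
      refine le_trans ?_ h1
      have : 0 ≤ s.re * ‖mlw x ^ (-(α:ℂ))‖ := mul_nonneg hs.1 (norm_nonneg _)
      nlinarith
    have h3 : ‖(s - z) * mlw x ^ (-(α:ℂ))‖ ≤ c / 2 := by
      rw [norm_mul, ← dist_eq_norm, dist_comm]
      have := mlv_le α hα0 x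
      nlinarith [norm_nonneg (mlw x ^ (-(α:ℂ))), dist_nonneg (x := z) (y := s)]
    have h4 : 1 + s * mlw x ^ (-(α:ℂ)) = (1 + z * mlw x ^ (-(α:ℂ))) +
      (s - z) * mlw x ^ (-(α:ℂ)) := by ring
    have h5 := norm_add_le (1 + z * mlw x ^ (-(α:ℂ))) ((s - z) * mlw x ^ (-(α:ℂ)))
    rw [← h4] at h5
    linarith
  have hne : ∀ z ∈ U, ∀ x, 1 + z * mlw x ^ (-(α:ℂ)) ≠ 0 := by
    intro z hz x h
    have := hlow z hz x
    rw [h, norm_zero] at this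
    linarith
  have hpow : ∀ z ∈ U, ∀ x, ∀ n : ℕ, ‖1 / (1 + z * mlw x ^ (-(α:ℂ))) ^ n‖ ≤ 1 / (c / 2) ^ n := by
    intro z hz x n
    rw [norm_div, norm_one, norm_pow]
    have := hlow z hz x
    gcongr
  have hcont : ∀ z ∈ U, ∀ n : ℕ, Continuous (fun x => 1 / (1 + z * mlw x ^ (-(α:ℂ))) ^ n) := by
    intro z hz n
    have := mlw_cpow_cont (-(α:ℂ))
    refine continuous_const.div (by fun_prop) fun x => pow_ne_zero _ (hne z hz x)
  have hd : DifferentiableOn ℂ (fun z : ℂ =>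
      ∫ x, mlh β x * (1 / (1 + z * mlw x ^ (-(α:ℂ))) ^ (j + 1))) U := by
    intro z₀ hz₀
    refine DifferentiableAt.differentiableWithinAt ?_
    refine (hasDerivAt_integral_of_dominated_loc_of_deriv_le (𝕜 := ℂ)
      (s := U) (μ := (volume : Measure ℝ))
      (F := fun (z : ℂ) (x : ℝ) => mlh β x * (1 / (1 + z * mlw x ^ (-(α:ℂ))) ^ (j + 1)))
      (F' := fun (z : ℂ) (x : ℝ) => mlh β x * (-((j:ℂ) + 1) * mlw x ^ (-(α:ℂ)) *
        (1 / (1 + z * mlw x ^ (-(α:ℂ))) ^ (j + 2))))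
      (bound := fun x => ‖mlh β x‖ * (((j:ℝ) + 1) * 1 * (1 / (c / 2) ^ (j + 2))))
      (hUo.mem_nhds hz₀) ?_ ?_ ?_ ?_ ?_ ?_).2.differentiableAt
    · filter_upwards [hUo.mem_nhds hz₀] with z hz
      exact ((mlh_cont β).mul (hcont z hz _)).aestronglyMeasurable
    · refine ((mlh_integrable β hβ).norm.mul_const (1 / (c / 2) ^ (j + 1))).mono'
        ((mlh_cont β).mul (hcont z₀ hz₀ _)).aestronglyMeasurable
        (Eventually.of_forall fun x => ?_)
      rw [norm_mul]
      have := hpow z₀ hz₀ x (j + 1)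
      gcongr
    · exact ((mlh_cont β).mul ((continuous_const.mul (mlw_cpow_cont _)).mul
        (hcont z₀ hz₀ _))).aestronglyMeasurable
    · refine Eventually.of_forall fun x z hz => ?_
      rw [norm_mul, norm_mul, norm_mul, norm_neg]
      have h1 := hpow z hz x (j + 2)
      have h2 := mlv_le α hα0 x
      have h3 : ‖(j:ℂ) + 1‖ = (j:ℝ) + 1 := by
        exact_mod_cast Complex.norm_natCast (j + 1)
      rw [h3]
      gcongr
    · exact (mlh_integrable β hβ).norm.mul_const _
    · refine Eventually.of_forall fun x z hz => ?_
      refine HasDerivAt.const_mul _ ?_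
      have hn := hne z hz x
      have h1 : HasDerivAt (fun z : ℂ => 1 + z * mlw x ^ (-(α:ℂ))) (mlw x ^ (-(α:ℂ))) z := by
        simpa using ((hasDerivAt_id z).mul_const (mlw x ^ (-(α:ℂ)))).const_add 1
      have h2 := (h1.fun_pow (j + 1)).fun_inv (pow_ne_zero _ hn)
      simp only [one_div]
      convert h2 using 1
      simp only [Nat.add_sub_cancel]
      push_cast
      generalize 1 + z * mlw x ^ (-(α:ℂ)) = q at hn
      have hq : (q ^ (j + 1)) ^ 2 = q ^ j * q ^ (j + 2) := by ring
      rw [hq]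
      field_simp
  refine (hd.analyticOnNhd hUo).eqOn_of_preconnected_of_eventuallyEq
    ((mlc_differentiable α β hα0 hβ j).differentiableOn.analyticOnNhd hUo)
    (hPc.thickening _).isPreconnected (z₀ := 0) (hPU (by simpa using hPt 0 le_rfl)) ?_
    (hPU (hPt t ht))
  filter_upwards [Metric.ball_mem_nhds (0:ℂ) one_pos] with z hz
  exact ml_near_zero α β hα0 hβ j z (by simpa using hz)

lemma ml_large (α β : ℝ) (hα0 : 0 < α) (hα2 : α < 2) (hβ : 1 + α < β) (j : ℕ) :
    ∃ C, ∀ t : ℝ, 0 ≤ t → |∑' k, mlc α β j k * (-t) ^ k| ≤ C / (1 + t) := by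
  set c := Real.cos (Real.pi * α / 4) with hc
  have hc0 : 0 < c := ml_cpos α hα0 hα2
  refine ⟨∫ x, (1 / c ^ (j + 1)) * ‖mlh (β - α) x‖, fun t ht => ?_⟩
  have h := ml_rep α β hα0 hα2 (by linarith) j t ht
  have h' : (∑' k, (mlc α β j k : ℂ) * (-(t:ℂ)) ^ k) = ((∑' k, mlc α β j k * (-t) ^ k : ℝ) : ℂ) := by
    push_cast; rfl
  rw [h'] at h
  rw [← Real.norm_eq_abs, ← Complex.norm_real, ← h, div_eq_mul_inv, ← integral_mul_const]
  refine norm_integral_le_of_norm_le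
    (((mlh_integrable (β - α) (by linarith)).norm.const_mul _).mul_const _)
    (Eventually.of_forall fun x => ?_)
  have h1 := ml_sector α hα0 hα2 x t ht
  have h2 := mlv_le α hα0 x
  set v := mlw x ^ (-(α:ℂ)) with hv
  have h3 : mlh β x = mlh (β - α) x * v := by
    have := mlh_pow α (β - α) 1 x
    rw [pow_one] at this
    rw [hv, this]; congr 1; push_cast; ring
  have hv0 : 0 < ‖v‖ := by
    rw [norm_pos_iff, hv]
    exact (Complex.cpow_ne_zero_iff_of_exponent_ne_zero (by
      simpa using hα0.ne')).2 (mlw_ne x)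
  have h4 : ‖v‖ * (1 + t) ≤ (1 + t * ‖v‖) ^ (j + 1) := by
    calc ‖v‖ * (1 + t) ≤ 1 + t * ‖v‖ := by nlinarith
      _ ≤ _ := le_self_pow₀ (by nlinarith [mul_nonneg ht hv0.le]) (by omega)
  have h5 : c ^ (j + 1) * (‖v‖ * (1 + t)) ≤ ‖1 + (t:ℂ) * v‖ ^ (j + 1) := by
    calc _ ≤ c ^ (j + 1) * (1 + t * ‖v‖) ^ (j + 1) := by gcongr
      _ = (c * (1 + t * ‖v‖)) ^ (j + 1) := by rw [mul_pow]
      _ ≤ _ := by gcongr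
  rw [h3, norm_mul, norm_mul, norm_div, norm_one, norm_pow]
  calc ‖mlh (β - α) x‖ * ‖v‖ * (1 / ‖1 + (t:ℂ) * v‖ ^ (j + 1)) ≤
      ‖mlh (β - α) x‖ * ‖v‖ * (1 / (c ^ (j + 1) * (‖v‖ * (1 + t)))) := by gcongr
    _ = _ := by field_simp

lemma mlc_step (α β : ℝ) (j k : ℕ) : mlc α (β - 1) j k =
    α * (j + 1) * mlc α β (j + 1) k + (β - 1 - α * (j + 1)) * mlc α β j k := by
  have hG : (Real.Gamma (k * α + (β - 1)))⁻¹ =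
      (k * α + β - 1) * (Real.Gamma (k * α + β))⁻¹ := by
    by_cases h : k * α + (β - 1) = 0
    · rw [h, Real.Gamma_zero, inv_zero, show k * α + β - 1 = 0 by linarith, zero_mul]
    · have := Real.Gamma_add_one h
      rw [show k * α + (β - 1) + 1 = k * α + β by ring] at this
      rw [this, show k * α + β - 1 = k * α + (β - 1) by ring, mul_inv, mul_inv_cancel_left₀ h]
  have hB : ((j:ℝ) + 1) * ((k + (j + 1)).choose (j + 1) : ℝ) = (k + j + 1) * ((k + j).choose j : ℝ) := by
    have := Nat.add_one_mul_choose_eq (k + j) j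
    have h2 : (((k + j + 1) * (k + j).choose j : ℕ) : ℝ) =
      (((k + j + 1).choose (j + 1) * (j + 1) : ℕ) : ℝ) := by exact_mod_cast this
    push_cast at h2
    rw [h2, ← add_assoc]; ring
  simp only [mlc]
  rw [hG]
  linear_combination (-α * (Real.Gamma (k * α + β))⁻¹) * hB

lemma ml_all (α : ℝ) (hα0 : 0 < α) (hα2 : α < 2) (n : ℕ) : ∀ (β : ℝ), 1 + α - n < β → ∀ j : ℕ,
    (∀ t : ℝ, Summable fun k => mlc α β j k * (-t) ^ k) ∧
    ∃ C, ∀ t : ℝ, 0 ≤ t → |∑' k, mlc α β j k * (-t) ^ k| ≤ C / (1 + t) := by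
  induction n with
  | zero =>
    intro β hβ j
    simp only [Nat.cast_zero, sub_zero] at hβ
    refine ⟨fun t => ?_, ml_large α β hα0 hα2 hβ j⟩
    have := mlc_summable α β hα0 (by linarith) j t
    rw [← Complex.summable_ofReal]
    simpa using this
  | succ n ih =>
    intro β hβ j
    push_cast at hβ
    obtain ⟨s1, C1, h1⟩ := ih (β + 1) (by linarith) (j + 1)
    obtain ⟨s2, C2, h2⟩ := ih (β + 1) (by linarith) j
    have hterm : ∀ t : ℝ, (fun k => mlc α β j k * (-t) ^ k) = fun k =>
        α * (j + 1) * (mlc α (β + 1) (j + 1) k * (-t) ^ k) +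
        (β - α * (j + 1)) * (mlc α (β + 1) j k * (-t) ^ k) := by
      intro t; funext k
      have := mlc_step α (β + 1) j k
      rw [add_sub_cancel_right] at this
      rw [this]; ring
    refine ⟨fun t => ?_, |α * (j + 1)| * C1 + |β - α * (j + 1)| * C2, fun t ht => ?_⟩
    · rw [hterm]; exact ((s1 t).mul_left _).add ((s2 t).mul_left _)
    · rw [hterm, ((s1 t).mul_left _).tsum_add ((s2 t).mul_left _), tsum_mul_left, tsum_mul_left]
      refine (abs_add_le _ _).trans ?_
      rw [abs_mul (α * (j + 1)), abs_mul (β - α * (j + 1)), add_div, mul_div_assoc, mul_div_assoc]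
      have := h1 t ht
      have := h2 t ht
      gcongr

theorem mittagLeffler_decay (α β : ℝ) (hα0 : 0 < α) (hα2 : α < 2) :
    ∃ C > 0, ∀ t : ℝ, 0 ≤ t → |mittagLeffler α β (-t)| ≤ C / (1 + t) := by
  obtain ⟨n, hn⟩ := exists_nat_gt (1 + α - β)
  obtain ⟨-, C, hC⟩ := ml_all α hα0 hα2 n β (by linarith) 0
  refine ⟨|C| + 1, by positivity, fun t ht => ?_⟩
  have h : mittagLeffler α β (-t) = ∑' k, mlc α β 0 k * (-t) ^ k := by
    simp only [mittagLeffler, mlc]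
    congr 1; funext k
    simp; ring
  rw [h]
  refine (hC t ht).trans ?_
  gcongr
  linarith [le_abs_self C]
end

section
/- Let 0 < α < 2 and β ∈ ℝ, and let p be a positive integer. Then, as t → ∞, E_{α,β}(−t) = −∑_{k=1}^p (−t)^{−k} / Γ(β − αk) + O(t^{−1−p}); that is, there exist constants C > 0 and t₀ > 0 such that for all t ≥ t₀, |E_{α,β}(−t) + ∑_{k=1}^p (−t)^{−k} / Γ(β − αk)| ≤ C t^{−1−p}. -/
open Complex MeasureTheory Set Filter Topology

lemma ml_integrable_rpow_exp {a c : ℝ} (ha : 0 < a) (hc : 0 < c) :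
    IntegrableOn (fun t : ℝ => t ^ (a - 1) * Real.exp (-c * t)) (Ioi 0) := by
  have := integrableOn_rpow_mul_exp_neg_mul_rpow (p := 1) (s := a - 1) (b := c) (by linarith)
    one_pos hc
  simpa using this

lemma ml_meas_integrand (a : ℝ) (r : ℂ) :
    AEStronglyMeasurable (fun t : ℝ => ((t ^ (a - 1) : ℝ) : ℂ) * cexp (-r * t))
      (volume.restrict (Ioi 0)) := by
  apply Measurable.aestronglyMeasurable
  fun_prop

lemma ml_norm_integrand {a : ℝ} {r : ℂ} {t : ℝ} (ht : 0 < t) :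
    ‖((t ^ (a - 1) : ℝ) : ℂ) * cexp (-r * t)‖ = t ^ (a - 1) * Real.exp (-r.re * t) := by
  rw [norm_mul, Complex.norm_exp, Complex.norm_real, Real.norm_of_nonneg (by positivity)]
  simp

lemma ml_integrableC {a : ℝ} {r : ℂ} (ha : 0 < a) (hr : 0 < r.re) :
    IntegrableOn (fun t : ℝ => ((t ^ (a - 1) : ℝ) : ℂ) * cexp (-r * t)) (Ioi 0) := by
  refine (ml_integrable_rpow_exp ha hr).mono' (ml_meas_integrand a r) ?_
  filter_upwards [ae_restrict_mem measurableSet_Ioi] with t ht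
  exact (ml_norm_integrand ht).le

lemma ml_laplace_s1 {a : ℝ} (ha : 0 < a) {r : ℂ} (hr : 0 < r.re) :
    ∫ t : ℝ in Ioi 0, ((t ^ (a - 1) : ℝ) : ℂ) * cexp (-r * t) = r ^ (-(a : ℂ)) * Real.Gamma a := by
  have hopen : IsOpen {r : ℂ | 0 < r.re} := isOpen_lt continuous_const Complex.continuous_re
  have hconn : IsPreconnected {r : ℂ | 0 < r.re} := (convex_halfSpace_re_gt 0).isPreconnected
  have hA : AnalyticOnNhd ℂ (fun r : ℂ => ∫ t : ℝ in Ioi 0, ((t ^ (a - 1) : ℝ) : ℂ) * cexp (-r * t))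
      {r : ℂ | 0 < r.re} := by
    apply DifferentiableOn.analyticOnNhd _ hopen
    intro r hr
    have hr : 0 < r.re := hr
    apply DifferentiableAt.differentiableWithinAt
    refine (hasDerivAt_integral_of_dominated_loc_of_deriv_le (s := Metric.ball r (r.re / 2))
      (bound := fun t => t ^ (a + 1 - 1) * Real.exp (-(r.re / 2) * t))
      (F' := fun x (t : ℝ) => ((t ^ (a - 1) : ℝ) : ℂ) * (cexp (-x * t) * (-t)))
      (Metric.ball_mem_nhds _ (by linarith))
      (Eventually.of_forall fun x => ml_meas_integrand a x) (ml_integrableC ha hr)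
      ?_ ?_ (ml_integrable_rpow_exp (by linarith) (by linarith)) ?_).2.differentiableAt
    · apply Measurable.aestronglyMeasurable
      fun_prop
    · filter_upwards [ae_restrict_mem measurableSet_Ioi] with t ht x hx
      have ht : 0 < t := ht
      have hx' : r.re / 2 ≤ x.re := by
        have h1 := (Complex.abs_re_le_norm (x - r)).trans_lt (by simpa [dist_eq_norm] using hx)
        rw [abs_lt, Complex.sub_re] at h1
        linarith [h1.1]
      rw [← mul_assoc, norm_mul, ml_norm_integrand ht, norm_neg, Complex.norm_real,
        Real.norm_of_nonneg ht.le]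
      have : t ^ (a + 1 - 1) = t ^ (a - 1) * t := by
        rw [← Real.rpow_add_one ht.ne']; congr 1; ring
      rw [this]
      have h3 : Real.exp (-x.re * t) ≤ Real.exp (-(r.re / 2) * t) := by
        apply Real.exp_le_exp.2; nlinarith
      calc _ = t ^ (a - 1) * t * Real.exp (-x.re * t) := by ring
        _ ≤ _ := by gcongr
    · refine Eventually.of_forall fun t x _ => ?_
      apply HasDerivAt.const_mul
      have : HasDerivAt (fun x : ℂ => -x * (t : ℂ)) (-t) x := by
        simpa using ((hasDerivAt_id x).neg.mul_const (t : ℂ))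
      exact this.cexp
  have hB : AnalyticOnNhd ℂ (fun r : ℂ => r ^ (-(a : ℂ)) * Real.Gamma a) {r : ℂ | 0 < r.re} := by
    apply DifferentiableOn.analyticOnNhd _ hopen
    intro r hr
    apply DifferentiableAt.differentiableWithinAt
    apply DifferentiableAt.mul_const
    exact (differentiableAt_id).cpow_const (Or.inl hr)
  have hreal : ∀ x : ℝ, 0 < x → ∫ t : ℝ in Ioi 0, ((t ^ (a - 1) : ℝ) : ℂ) * cexp (-(x : ℂ) * t)
      = (x : ℂ) ^ (-(a : ℂ)) * Real.Gamma a := by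
    intro x hx
    have h := Real.integral_rpow_mul_exp_neg_mul_Ioi ha hx
    have h2 : ∫ t : ℝ in Ioi 0, ((t ^ (a - 1) : ℝ) : ℂ) * cexp (-(x : ℂ) * t) =
       ((∫ t : ℝ in Ioi 0, t ^ (a - 1) * Real.exp (-(x * t)) : ℝ) : ℂ) := by
      rw [← integral_complex_ofReal]
      congr 1
      ext t
      push_cast
      ring_nf
    rw [h2, h]
    rw [one_div, Real.inv_rpow hx.le, ← Real.rpow_neg hx.le]
    push_cast
    rw [Complex.ofReal_cpow hx.le]
    push_cast
    rfl
  refine hA.eqOn_of_preconnected_of_frequently_eq hB hconn (z₀ := 1) (by simp) ?_ hr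
  have ht : Tendsto (fun x : ℝ => (x : ℂ)) (𝓝[≠] 1) (𝓝[≠] 1) := by
    apply tendsto_nhdsWithin_of_tendsto_nhds_of_eventually_within
    · exact (Complex.continuous_ofReal.tendsto' 1 1 (by simp)).mono_left nhdsWithin_le_nhds
    · filter_upwards [self_mem_nhdsWithin] with x hx
      simpa using hx
  apply ht.frequently
  apply Eventually.frequently
  filter_upwards [nhdsWithin_le_nhds (lt_mem_nhds (zero_lt_one (α := ℝ)))] with x hx
  exact hreal x hx

/-- The vertical line `c + 2πiξ`. -/
noncomputable def mlLine (c ξ : ℝ) : ℂ := c + 2 * Real.pi * ξ * I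

lemma mlLine_re (c ξ : ℝ) : (mlLine c ξ).re = c := by simp [mlLine]
lemma mlLine_im (c ξ : ℝ) : (mlLine c ξ).im = 2 * Real.pi * ξ := by simp [mlLine]

lemma mlLine_ne {c : ℝ} (hc : 0 < c) (ξ : ℝ) : mlLine c ξ ≠ 0 := by
  intro h
  have := mlLine_re c ξ
  rw [h] at this
  simp at this
  linarith

lemma mlLine_cont (c : ℝ) : Continuous (mlLine c) := by unfold mlLine; fun_prop

lemma mlLine_cpow_cont {c : ℝ} (hc : 0 < c) (x : ℂ) : Continuous fun ξ => mlLine c ξ ^ x :=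
  (mlLine_cont c).cpow continuous_const fun ξ => Or.inl (by rw [mlLine_re]; exact hc)

lemma mlLine_norm_ge {c : ℝ} (hc : 0 < c) (ξ : ℝ) : c ≤ ‖mlLine c ξ‖ := by
  have := Complex.abs_re_le_norm (mlLine c ξ)
  rw [mlLine_re, abs_of_pos hc] at this
  exact this

lemma mlLine_norm_ge' {c : ℝ} (hc : 0 < c) (ξ : ℝ) :
    min c 1 / 2 * (1 + ‖ξ‖) ≤ ‖mlLine c ξ‖ := by
  have h1 := mlLine_norm_ge hc ξ
  have h2 := Complex.abs_im_le_norm (mlLine c ξ)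
  rw [mlLine_im, abs_mul, abs_of_pos (by positivity)] at h2
  rw [Real.norm_eq_abs]
  have h3 : |ξ| ≤ ‖mlLine c ξ‖ := by nlinarith [Real.pi_gt_three, abs_nonneg ξ]
  have h4 : min c 1 ≤ c := min_le_left _ _
  have h5 : min c 1 ≤ 1 := min_le_right _ _
  nlinarith [abs_nonneg ξ]

lemma mlLine_norm_cpow {c : ℝ} (_hc : 0 < c) (ξ x : ℝ) :
    ‖mlLine c ξ ^ (-(x : ℂ))‖ = ‖mlLine c ξ‖ ^ (-x) := by
  rw [← Complex.ofReal_neg, Complex.norm_cpow_real]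

lemma mlLine_integrable {c x : ℝ} (hc : 0 < c) (hx : 1 < x) :
    Integrable fun ξ => ‖mlLine c ξ‖ ^ (-x) := by
  have h := (integrable_one_add_norm (E := ℝ) (μ := volume) (r := x) (by simpa using hx)).const_mul
    ((min c 1 / 2) ^ (-x))
  refine h.mono' ?_ ?_
  · have := (mlLine_cpow_cont hc (-(x : ℂ))).norm
    simp_rw [mlLine_norm_cpow hc] at this
    exact this.aestronglyMeasurable
  · refine Eventually.of_forall fun ξ => ?_
    have hm : 0 < min c 1 := lt_min hc one_pos
    rw [Real.norm_of_nonneg (by positivity), ← Real.mul_rpow (by positivity) (by positivity)]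
    exact Real.rpow_le_rpow_of_nonpos (by positivity) (mlLine_norm_ge' hc ξ) (by linarith)

lemma mlLine_integrableC {c x : ℝ} (hc : 0 < c) (hx : 1 < x) :
    Integrable fun ξ => mlLine c ξ ^ (-(x : ℂ)) := by
  refine (mlLine_integrable hc hx).mono' (mlLine_cpow_cont hc _).aestronglyMeasurable ?_
  exact Eventually.of_forall fun ξ => (mlLine_norm_cpow hc ξ x).le

open FourierTransform in
lemma ml_inv_gamma {c x : ℝ} (hc : 0 < c) (hx : 1 < x) :
    (((Real.Gamma x)⁻¹ : ℝ) : ℂ) = ∫ ξ : ℝ, cexp (mlLine c ξ) * mlLine c ξ ^ (-(x : ℂ)) := by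
  have hx0 : 0 < x := by linarith
  set f : ℝ → ℂ := (Ioi (0 : ℝ)).indicator fun t : ℝ => ((t ^ (x - 1) : ℝ) : ℂ) * cexp (-(c : ℂ) * t)
    with hf
  have hfi : Integrable f :=
    (integrable_indicator_iff measurableSet_Ioi).2 (ml_integrableC hx0 (by simpa using hc))
  have hF : 𝓕 f = fun ξ => mlLine c ξ ^ (-(x : ℂ)) * Real.Gamma x := by
    ext ξ
    rw [Real.fourier_real_eq_integral_exp_smul, ← ml_laplace_s1 hx0 (by rw [mlLine_re]; exact hc),
      ← integral_indicator measurableSet_Ioi]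
    congr 1
    ext t
    by_cases ht : t ∈ Ioi (0 : ℝ)
    · simp only [hf, indicator_of_mem ht, smul_eq_mul]
      rw [mul_left_comm, ← Complex.exp_add]
      congr 2
      simp only [mlLine]
      push_cast
      ring
    · simp [hf, indicator_of_notMem ht]
  have hcont : ContinuousAt f 1 := by
    have : (fun t : ℝ => ((t ^ (x - 1) : ℝ) : ℂ) * cexp (-(c : ℂ) * t)) =ᶠ[𝓝 1] f := by
      filter_upwards [lt_mem_nhds (zero_lt_one (α := ℝ))] with t ht
      rw [hf, indicator_of_mem (mem_Ioi.2 ht)]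
    refine ContinuousAt.congr ?_ this
    apply ContinuousAt.mul
    · apply Complex.continuous_ofReal.continuousAt.comp
      exact Real.continuousAt_rpow_const _ _ (Or.inl one_ne_zero)
    · fun_prop
  have hFi : Integrable (𝓕 f) := by
    rw [hF]; exact (mlLine_integrableC hc hx).mul_const _
  have key := hfi.fourierInv_fourier_eq hFi hcont
  rw [hF, Real.fourierInv_eq'] at key
  have h1 : f 1 = cexp (-(c : ℂ)) := by
    rw [hf, indicator_of_mem (by simp)]
    simp
  rw [h1] at key
  have hG : (Real.Gamma x : ℂ) ≠ 0 := by
    exact_mod_cast (Real.Gamma_pos_of_pos hx0).ne'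
  have h2 : ∫ ξ : ℝ, cexp (mlLine c ξ) * mlLine c ξ ^ (-(x : ℂ)) =
      cexp c * (Real.Gamma x : ℂ)⁻¹ * ∫ ξ : ℝ, cexp (↑(2 * Real.pi * inner ℝ ξ 1) * I) •
        (mlLine c ξ ^ (-(x : ℂ)) * Real.Gamma x) := by
    rw [← integral_const_mul]
    congr 1
    ext ξ
    have : mlLine c ξ = c + ↑(2 * Real.pi * inner ℝ ξ 1) * I := by
      simp [mlLine]
    nth_rewrite 1 [this]
    rw [Complex.exp_add, smul_eq_mul]
    field_simp
  rw [h2, key]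
  rw [mul_right_comm, ← Complex.exp_add]
  simp

lemma ml_inv_gamma_bound {c : ℝ} (hc : 0 < c) :
    ∃ K : ℝ, ∀ x : ℝ, 2 ≤ x → |(Real.Gamma x)⁻¹| ≤ K * c ^ (-x) := by
  refine ⟨Real.exp c * c ^ (2 : ℝ) * ∫ ξ, ‖mlLine c ξ‖ ^ (-2 : ℝ), fun x hx => ?_⟩
  have h : |(Real.Gamma x)⁻¹| = ‖(((Real.Gamma x)⁻¹ : ℝ) : ℂ)‖ := by
    rw [Complex.norm_real, Real.norm_eq_abs]
  rw [h, ml_inv_gamma hc (by linarith), mul_right_comm, ← integral_const_mul]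
  apply norm_integral_le_of_norm_le ((mlLine_integrable hc (by norm_num)).const_mul _)
  refine Eventually.of_forall fun ξ => ?_
  rw [norm_mul, mlLine_norm_cpow hc, Complex.norm_exp, mlLine_re, mul_assoc (Real.exp c),
    mul_assoc (Real.exp c)]
  gcongr
  have h1 := mlLine_norm_ge hc ξ
  have h0 : 0 < ‖mlLine c ξ‖ := by linarith
  rw [← Real.rpow_add hc, show -x = (2 + -x) + -2 by ring, Real.rpow_add h0]
  gcongr ?_ * _
  rw [show 2 + (2 + -x + -2) = 2 + -x by ring]
  exact Real.rpow_le_rpow_of_nonpos hc h1 (by linarith)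

lemma ml_summable {α : ℝ} (hα : 0 < α) (b : ℝ) {R : ℝ} (hR : 0 < R) :
    Summable fun k : ℕ => R ^ k * |(Real.Gamma (k * α + b))⁻¹| := by
  set c := (2 * R) ^ (1 / α) with hcdef
  have hc : 0 < c := by positivity
  have hcα : c ^ α = 2 * R := by
    rw [hcdef, ← Real.rpow_mul (by positivity)]
    simp [hα.ne']
  obtain ⟨K, hK⟩ := ml_inv_gamma_bound hc
  have hg : Summable fun k : ℕ => K * c ^ (-b) * (1 / 2 : ℝ) ^ k :=
    (summable_geometric_of_lt_one (by norm_num) (by norm_num)).mul_left _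
  refine hg.of_norm_bounded_eventually_nat ?_
  have ht : Tendsto (fun k : ℕ => (k : ℝ) * α + b) atTop atTop :=
    tendsto_atTop_add_const_right _ _ (tendsto_natCast_atTop_atTop.atTop_mul_const hα)
  filter_upwards [ht.eventually_ge_atTop 2] with k hk
  rw [Real.norm_of_nonneg (by positivity)]
  refine (mul_le_mul_of_nonneg_left (hK _ hk) (by positivity)).trans_eq ?_
  have : c ^ (-(k * α + b)) = ((2 * R) ^ k)⁻¹ * c ^ (-b) := by
    rw [neg_add, Real.rpow_add hc, ← hcα, Real.rpow_neg hc.le, mul_comm (k : ℝ) α,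
      Real.rpow_mul hc.le, Real.rpow_natCast]
  rw [this, mul_pow, one_div, inv_pow]
  field_simp

/-- Complex Mittag-Leffler function. -/
noncomputable def mlC (α b : ℝ) (z : ℂ) : ℂ :=
  ∑' k : ℕ, z ^ k * (((Real.Gamma (k * α + b))⁻¹ : ℝ) : ℂ)

lemma mlC_term_le (α b : ℝ) {R : ℝ} (k : ℕ) (w : ℂ) (hw : w ∈ Metric.ball (0 : ℂ) R) :
    ‖w ^ k * (((Real.Gamma (k * α + b))⁻¹ : ℝ) : ℂ)‖ ≤ R ^ k * |(Real.Gamma (k * α + b))⁻¹| := by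
  rw [norm_mul, norm_pow, Complex.norm_real, Real.norm_eq_abs]
  have : ‖w‖ < R := by simpa using hw
  gcongr

lemma mlC_summable {α : ℝ} (hα : 0 < α) (b : ℝ) (z : ℂ) :
    Summable fun k : ℕ => z ^ k * (((Real.Gamma (k * α + b))⁻¹ : ℝ) : ℂ) := by
  refine (ml_summable hα b (R := ‖z‖ + 1) (by positivity)).of_norm_bounded fun k => ?_
  exact mlC_term_le α b k z (by simp)

lemma mlC_differentiable {α : ℝ} (hα : 0 < α) (b : ℝ) : Differentiable ℂ (mlC α b) := by
  intro z
  have h := differentiableOn_tsum_of_summable_norm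
    (F := fun (k : ℕ) (z : ℂ) => z ^ k * (((Real.Gamma (k * α + b))⁻¹ : ℝ) : ℂ))
    (ml_summable hα b (R := ‖z‖ + 1) (by positivity)) (fun k => by fun_prop)
    Metric.isOpen_ball (fun k w hw => mlC_term_le α b k w hw)
  exact h.differentiableAt (Metric.isOpen_ball.mem_nhds (by simp))

lemma ml_inv_gamma_rec (s : ℝ) : (Real.Gamma s)⁻¹ = s * (Real.Gamma (s + 1))⁻¹ := by
  rcases ne_or_eq s 0 with (h | rfl)
  · rw [Real.Gamma_add_one h, mul_inv, mul_inv_cancel_left₀ h]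
  · rw [zero_add, Real.Gamma_zero, inv_zero, zero_mul]

lemma mlC_deriv {α : ℝ} (hα : 0 < α) (b : ℝ) (z : ℂ) :
    mlC α (b - 1) z = α * z * deriv (mlC α b) z + (b - 1) * mlC α b z := by
  have h := hasSum_deriv_of_summable_norm
    (F := fun (k : ℕ) (z : ℂ) => z ^ k * (((Real.Gamma (k * α + b))⁻¹ : ℝ) : ℂ))
    (ml_summable hα b (R := ‖z‖ + 1) (by positivity)) (fun k => by fun_prop)
    Metric.isOpen_ball (fun k w hw => mlC_term_le α b k w hw) (z := z) (by simp)
  have h1 := (h.mul_left (α * z : ℂ)).add ((mlC_summable hα b z).hasSum.mul_left (b - 1 : ℂ))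
  refine HasSum.tsum_eq (f := fun k : ℕ =>
      z ^ k * (((Real.Gamma (k * α + (b - 1)))⁻¹ : ℝ) : ℂ)) ?_
  convert! h1 using 1
  funext k
  rw [ml_inv_gamma_rec, show k * α + (b - 1) + 1 = k * α + b by ring]
  rw [deriv_mul_const (by fun_prop), deriv_pow_field]
  push_cast
  rcases k with _ | k
  · simp
  · simp only [Nat.add_sub_cancel]
    push_cast
    ring

lemma mlC_rec {α : ℝ} (hα : 0 < α) (b : ℝ) (z : ℂ) :
    mlC α b z = (((Real.Gamma b)⁻¹ : ℝ) : ℂ) + z * mlC α (b + α) z := by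
  have h := (mlC_summable hα b z).tsum_eq_zero_add
  unfold mlC
  rw [h, ← tsum_mul_left]
  congr 1
  · simp
  · congr 1
    ext k
    rw [pow_succ, show ((k + 1 : ℕ) : ℝ) * α + b = k * α + (b + α) by push_cast; ring]
    ring

lemma mlC_ofReal (α b t : ℝ) : mlC α b t = ((∑' k : ℕ, t ^ k / Real.Gamma (k * α + b) : ℝ) : ℂ) := by
  rw [mlC, Complex.ofReal_tsum]
  congr 1
  ext k
  push_cast
  rw [div_eq_mul_inv]

/-- Conical neighbourhood of the negative axis. -/
def mlS (δ : ℝ) : Set ℂ := {z | ∃ t : ℝ, 0 < t ∧ ‖z + t‖ < δ * t}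

lemma mlS_open (δ : ℝ) : IsOpen (mlS δ) := by
  have : mlS δ = ⋃ t : ℝ, ⋃ _ : 0 < t, {z : ℂ | ‖z + t‖ < δ * t} := by
    ext z; simp [mlS]
  rw [this]
  refine isOpen_iUnion fun t => isOpen_iUnion fun _ => ?_
  exact isOpen_lt (by fun_prop) continuous_const

lemma mlS_convex (δ : ℝ) : Convex ℝ (mlS δ) := by
  rw [convex_iff_forall_pos]
  rintro x ⟨t, ht, hx⟩ y ⟨u, hu, hy⟩ p q hp hq _
  refine ⟨p * t + q * u, by positivity, ?_⟩
  have : p • x + q • y + ((p * t + q * u : ℝ) : ℂ) = p • (x + t) + q • (y + u) := by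
    simp only [Complex.real_smul]; push_cast; ring
  rw [this]
  refine (norm_add_le _ _).trans_lt ?_
  rw [norm_smul, norm_smul, Real.norm_of_nonneg hp.le, Real.norm_of_nonneg hq.le]
  nlinarith [mul_lt_mul_of_pos_left hx hp, mul_lt_mul_of_pos_left hy hq]

/-- Downward step. -/
lemma ml_step {α : ℝ} (hα : 0 < α) (b : ℝ)
    (h : ∃ δ > 0, ∃ C, ∀ z ∈ mlS δ, ‖mlC α b z‖ ≤ C) :
    ∃ δ > 0, ∃ C, ∀ z ∈ mlS δ, ‖mlC α (b - 1) z‖ ≤ C := by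
  obtain ⟨δ, hδ, C, hC⟩ := h
  refine ⟨δ / 4, by linarith, α * (1 + δ) * (C / (δ / 4)) + |b - 1| * C, ?_⟩
  rintro z ⟨t, ht, hz⟩
  have hzt : ‖z‖ ≤ (1 + δ) * t := by
    have : ‖z‖ ≤ ‖z + t‖ + ‖(t : ℂ)‖ := by
      simpa using norm_sub_le (z + t) (t : ℂ)
    rw [Complex.norm_real, Real.norm_of_nonneg ht.le] at this
    nlinarith
  have hd : ‖deriv (mlC α b) z‖ ≤ C / (δ / 4 * t) := by
    apply Complex.norm_deriv_le_of_forall_mem_sphere_norm_le (by positivity)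
    · exact (mlC_differentiable hα b).diffContOnCl
    · intro w hw
      apply hC
      refine ⟨t, ht, ?_⟩
      have h1 : ‖w - z‖ = δ / 4 * t := by simpa [dist_eq_norm] using hw
      have h2 : ‖w + t‖ ≤ ‖w - z‖ + ‖z + t‖ := by
        have := norm_add_le (w - z) (z + t)
        rwa [show w - z + (z + t) = w + t by ring] at this
      nlinarith [mul_pos hδ ht]
  have hC0 : ‖mlC α b z‖ ≤ C := hC z ⟨t, ht, hz.trans (by nlinarith [mul_pos hδ ht])⟩
  rw [mlC_deriv hα]
  refine (norm_add_le _ _).trans ?_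
  rw [norm_mul, norm_mul, norm_mul, Complex.norm_real, Real.norm_of_nonneg hα.le]
  have hb : ‖((b : ℂ) - 1)‖ = |b - 1| := by
    rw [← Real.norm_eq_abs, ← Complex.norm_real]; push_cast; rfl
  rw [hb]
  have hC1 : 0 ≤ C := (norm_nonneg _).trans hC0
  have : α * ‖z‖ * ‖deriv (mlC α b) z‖ ≤ α * (1 + δ) * (C / (δ / 4)) := by
    calc _ ≤ α * ((1 + δ) * t) * (C / (δ / 4 * t)) := by gcongr
      _ = _ := by field_simp
  gcongr

lemma ml_sector_s1 {α : ℝ} (hα0 : 0 < α) (hα2 : α < 2) :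
    ∃ κ > 0, ∀ z ∈ mlS κ, ∀ ξ : ℝ, κ ≤ ‖1 - z * mlLine 1 ξ ^ (-(α : ℂ))‖ := by
  set m := (1 + Real.cos (α * (Real.pi / 2))) / 2 with hm
  have hpi := Real.pi_pos
  have hm0 : 0 < m := by
    have : Real.cos Real.pi < Real.cos (α * (Real.pi / 2)) :=
      Real.cos_lt_cos_of_nonneg_of_le_pi (by positivity) le_rfl (by nlinarith)
    rw [Real.cos_pi] at this
    rw [hm]; linarith
  have hm1 : m ≤ 1 := by
    have := Real.cos_le_one (α * (Real.pi / 2))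
    rw [hm]; linarith
  have hs : 0 < Real.sqrt m := Real.sqrt_pos.2 hm0
  refine ⟨Real.sqrt m / 2, by positivity, ?_⟩
  rintro z ⟨t, ht, hz⟩ ξ
  set s := mlLine 1 ξ with hsdef
  set v := s ^ (-(α : ℂ)) with hv
  have hsne : s ≠ 0 := mlLine_ne one_pos ξ
  -- real part of v
  have hre : ‖v‖ * Real.cos (α * (Real.pi / 2)) ≤ v.re := by
    have harg : |s.arg| ≤ Real.pi / 2 := by
      rw [Complex.abs_arg_le_pi_div_two_iff, hsdef, mlLine_re]; norm_num
    have hvn : ‖v‖ = Real.exp ((Complex.log s * (-(α : ℂ))).re) := by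
      rw [hv, Complex.cpow_def_of_ne_zero hsne, Complex.norm_exp]
    have hvr : v.re = ‖v‖ * Real.cos (α * s.arg) := by
      rw [hvn, hv, Complex.cpow_def_of_ne_zero hsne, Complex.exp_re]
      congr 1
      rw [← Real.cos_neg]
      congr 1
      simp [Complex.mul_im, Complex.log_im]
      ring
    rw [hvr]
    gcongr
    rw [← Real.cos_abs (α * s.arg), abs_mul, abs_of_pos hα0]
    apply Real.cos_le_cos_of_nonneg_of_le_pi (by positivity) (by nlinarith)
    gcongr
  have h1 : Real.sqrt m * (1 + t * ‖v‖) ≤ ‖1 + t * v‖ := by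
    apply le_of_sq_le_sq _ (norm_nonneg _)
    rw [mul_pow, Real.sq_sqrt hm0.le, Complex.sq_norm, Complex.normSq_apply]
    have h3 : ‖v‖ ^ 2 = v.re * v.re + v.im * v.im := by
      rw [Complex.sq_norm, Complex.normSq_apply]
    simp only [Complex.add_re, Complex.one_re, Complex.mul_re, Complex.ofReal_re,
      Complex.ofReal_im, Complex.add_im, Complex.one_im, Complex.mul_im]
    have h4 : Real.cos (α * (Real.pi / 2)) = 2 * m - 1 := by rw [hm]; ring
    rw [h4] at hre
    have h5 : t * (‖v‖ * (2 * m - 1)) ≤ t * v.re := by gcongr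
    have h6 : 0 ≤ (1 - m) * (1 - t * ‖v‖) ^ 2 := by
      apply mul_nonneg (by linarith) (sq_nonneg _)
    have h7 : (t * ‖v‖) ^ 2 = t ^ 2 * (v.re * v.re + v.im * v.im) := by rw [mul_pow, h3]
    nlinarith
  have h2 : ‖1 + t * v‖ ≤ ‖1 - z * v‖ + ‖z + t‖ * ‖v‖ := by
    rw [← norm_mul]
    refine le_trans (le_of_eq ?_) (norm_add_le _ _)
    congr 1; ring
  have h3 : ‖z + t‖ * ‖v‖ ≤ Real.sqrt m / 2 * t * ‖v‖ := by gcongr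
  nlinarith [mul_nonneg hs.le (mul_nonneg ht.le (norm_nonneg v))]

lemma mlLine_one_norm_cpow_le (ξ : ℝ) {α : ℝ} (hα : 0 ≤ α) :
    ‖mlLine 1 ξ ^ (-(α : ℂ))‖ ≤ 1 := by
  rw [mlLine_norm_cpow one_pos]
  exact Real.rpow_le_one_of_one_le_of_nonpos (mlLine_norm_ge one_pos ξ) (by linarith)

/-- The integrand. -/
noncomputable def mlG (α b : ℝ) (z : ℂ) (ξ : ℝ) : ℂ :=
  cexp (mlLine 1 ξ) * mlLine 1 ξ ^ (-(b : ℂ)) * (1 - z * mlLine 1 ξ ^ (-(α : ℂ)))⁻¹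

lemma mlG_pre_norm (b ξ : ℝ) : ‖cexp (mlLine 1 ξ) * mlLine 1 ξ ^ (-(b : ℂ))‖ =
    Real.exp 1 * ‖mlLine 1 ξ‖ ^ (-b) := by
  rw [norm_mul, mlLine_norm_cpow one_pos, Complex.norm_exp, mlLine_re]

lemma mlG_small {α b : ℝ} (hα : 0 < α) (hb : 1 < b) {z : ℂ} (hz : ‖z‖ < 1) :
    mlC α b z = ∫ ξ, mlG α b z ξ := by
  set F : ℕ → ℝ → ℂ := fun k ξ => z ^ k * (cexp (mlLine 1 ξ) * mlLine 1 ξ ^ (-((k * α + b : ℝ) : ℂ)))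
    with hF
  have hkb : ∀ k : ℕ, 1 < k * α + b := fun k => by
    have : 0 ≤ k * α := by positivity
    linarith
  have hF' : ∀ k ξ, F k ξ = cexp (mlLine 1 ξ) * mlLine 1 ξ ^ (-(b : ℂ)) *
      (z * mlLine 1 ξ ^ (-(α : ℂ))) ^ k := by
    intro k ξ
    simp only [hF]
    have : (-((k * α + b : ℝ) : ℂ)) = (k : ℂ) * (-(α : ℂ)) + (-(b : ℂ)) := by push_cast; ring
    rw [this, Complex.cpow_add _ _ (mlLine_ne one_pos ξ), Complex.cpow_nat_mul, mul_pow]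
    ring
  have hbi := (mlLine_integrable (c := 1) one_pos hb).const_mul (Real.exp 1)
  have hFb : ∀ k ξ, ‖F k ξ‖ ≤ Real.exp 1 * ‖mlLine 1 ξ‖ ^ (-b) * ‖z‖ ^ k := by
    intro k ξ
    rw [hF', norm_mul, mlG_pre_norm, norm_pow, norm_mul]
    gcongr
    exact mul_le_of_le_one_right (norm_nonneg _) (mlLine_one_norm_cpow_le ξ hα.le)
  have hFi : ∀ k, Integrable (F k) := by
    intro k
    refine (hbi.mul_const (‖z‖ ^ k)).mono' ?_ (Eventually.of_forall (hFb k))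
    apply Continuous.aestronglyMeasurable
    exact continuous_const.mul ((mlLine_cont 1).cexp.mul (mlLine_cpow_cont one_pos _))
  have hsum : Summable fun k => ∫ ξ, ‖F k ξ‖ := by
    refine Summable.of_nonneg_of_le (fun k => integral_nonneg fun _ => norm_nonneg _)
      (fun k => integral_mono (hFi k).norm (hbi.mul_const (‖z‖ ^ k)) (hFb k)) ?_
    simp_rw [integral_mul_const]
    exact (summable_geometric_of_lt_one (norm_nonneg _) hz).mul_left _
  have h := hasSum_integral_of_summable_integral_norm hFi hsum
  have h1 : ∀ k : ℕ, ∫ ξ, F k ξ = z ^ k * (((Real.Gamma (k * α + b))⁻¹ : ℝ) : ℂ) := by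
    intro k
    rw [ml_inv_gamma one_pos (hkb k), integral_const_mul]
  simp_rw [h1] at h
  rw [mlC, h.tsum_eq]
  congr 1
  ext ξ
  simp_rw [hF']
  rw [tsum_mul_left, tsum_geometric_of_norm_lt_one, mlG]
  rw [norm_mul]
  exact (mul_le_of_le_one_right (norm_nonneg _) (mlLine_one_norm_cpow_le ξ hα.le)).trans_lt hz

lemma mlG_meas {α b : ℝ} (z : ℂ) : AEStronglyMeasurable (mlG α b z) := by
  have h1 := (mlLine_cpow_cont one_pos (-(b : ℂ))).measurable
  have h2 := (mlLine_cpow_cont one_pos (-(α : ℂ))).measurable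
  have h3 := (mlLine_cont 1).cexp.measurable
  apply Measurable.aestronglyMeasurable
  unfold mlG
  fun_prop

lemma ml_base {α : ℝ} (hα0 : 0 < α) (hα2 : α < 2) {b : ℝ} (hb : 1 < b) :
    ∃ δ > 0, ∃ C, ∀ z ∈ mlS δ, ‖mlC α b z‖ ≤ C := by
  obtain ⟨κ, hκ, hsec⟩ := ml_sector_s1 hα0 hα2
  have hbi := (mlLine_integrable (c := 1) one_pos hb).const_mul (Real.exp 1)
  have hGb : ∀ z ∈ mlS κ, ∀ ξ, ‖mlG α b z ξ‖ ≤ Real.exp 1 * ‖mlLine 1 ξ‖ ^ (-b) * κ⁻¹ := by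
    intro z hz ξ
    rw [mlG, norm_mul, mlG_pre_norm, norm_inv]
    gcongr
    exact hsec z hz ξ
  have hGi : ∀ z ∈ mlS κ, Integrable (mlG α b z) := fun z hz =>
    (hbi.mul_const κ⁻¹).mono' (mlG_meas z) (Eventually.of_forall (hGb z hz))
  have hA : AnalyticOnNhd ℂ (fun z => ∫ ξ, mlG α b z ξ) (mlS κ) := by
    apply DifferentiableOn.analyticOnNhd _ (mlS_open κ)
    intro z hz
    apply DifferentiableAt.differentiableWithinAt
    refine (hasDerivAt_integral_of_dominated_loc_of_deriv_le (s := mlS κ)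
      (bound := fun ξ => Real.exp 1 * ‖mlLine 1 ξ‖ ^ (-b) * (κ ^ 2)⁻¹)
      (F' := fun z ξ => cexp (mlLine 1 ξ) * mlLine 1 ξ ^ (-(b : ℂ)) *
        (mlLine 1 ξ ^ (-(α : ℂ)) / (1 - z * mlLine 1 ξ ^ (-(α : ℂ))) ^ 2))
      ((mlS_open κ).mem_nhds hz)
      (Eventually.of_forall fun x => mlG_meas x) (hGi z hz)
      ?_ ?_ (hbi.mul_const _) ?_).2.differentiableAt
    · have h1 := (mlLine_cpow_cont one_pos (-(b : ℂ))).measurable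
      have h2 := (mlLine_cpow_cont one_pos (-(α : ℂ))).measurable
      have h3 := (mlLine_cont 1).cexp.measurable
      apply Measurable.aestronglyMeasurable
      fun_prop
    · refine Eventually.of_forall fun ξ w hw => ?_
      rw [norm_mul, mlG_pre_norm, norm_div, norm_pow, ← one_div]
      gcongr
      · exact mlLine_one_norm_cpow_le ξ hα0.le
      · exact hsec w hw ξ
    · refine Eventually.of_forall fun ξ w hw => ?_
      apply HasDerivAt.const_mul
      have hne : 1 - w * mlLine 1 ξ ^ (-(α : ℂ)) ≠ 0 := by
        rw [← norm_pos_iff]; exact hκ.trans_le (hsec w hw ξ)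
      have h1 : HasDerivAt (fun w : ℂ => 1 - w * mlLine 1 ξ ^ (-(α : ℂ)))
          (-(mlLine 1 ξ ^ (-(α : ℂ)))) w := by
        simpa using ((hasDerivAt_id w).mul_const (mlLine 1 ξ ^ (-(α : ℂ)))).const_sub 1
      have h2 := h1.inv hne
      rw [neg_neg] at h2
      exact h2
  have hE : AnalyticOnNhd ℂ (mlC α b) (mlS κ) :=
    (mlC_differentiable hα0 b).differentiableOn.analyticOnNhd (mlS_open κ)
  have heq : EqOn (mlC α b) (fun z => ∫ ξ, mlG α b z ξ) (mlS κ) := by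
    refine hE.eqOn_of_preconnected_of_eventuallyEq hA (mlS_convex κ).isPreconnected
      (z₀ := (-(1 / 2 : ℝ) : ℂ)) ⟨1 / 2, by norm_num, by simp [hκ]⟩ ?_
    have : Metric.ball (0 : ℂ) 1 ∈ 𝓝 (-(1 / 2 : ℝ) : ℂ) := by
      apply Metric.isOpen_ball.mem_nhds
      simp
      norm_num
    filter_upwards [this] with z hz
    exact mlG_small hα0 hb (by simpa using hz)
  refine ⟨κ, hκ, ∫ ξ, Real.exp 1 * ‖mlLine 1 ξ‖ ^ (-b) * κ⁻¹, fun z hz => ?_⟩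
  rw [heq hz]
  exact norm_integral_le_of_norm_le (hbi.mul_const κ⁻¹) (Eventually.of_forall (hGb z hz))

lemma ml_all_s1 {α : ℝ} (hα0 : 0 < α) (hα2 : α < 2) (n : ℕ) :
    ∀ b : ℝ, 1 < b + n → ∃ δ > 0, ∃ C, ∀ z ∈ mlS δ, ‖mlC α b z‖ ≤ C := by
  induction n with
  | zero => intro b hb; exact ml_base hα0 hα2 (by simpa using hb)
  | succ n ih =>
    intro b hb
    have := ml_step hα0 (b + 1) (ih (b + 1) (by push_cast at hb; linarith))
    simpa using this

lemma ml_real_bound {α : ℝ} (hα0 : 0 < α) (hα2 : α < 2) (b : ℝ) :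
    ∃ C, ∀ t : ℝ, 0 < t → |∑' k : ℕ, (-t) ^ k / Real.Gamma (k * α + b)| ≤ C := by
  obtain ⟨n, hn⟩ := exists_nat_gt (1 - b)
  obtain ⟨δ, hδ, C, hC⟩ := ml_all_s1 hα0 hα2 n b (by linarith)
  refine ⟨C, fun t ht => ?_⟩
  have := hC ((-t : ℝ) : ℂ) ⟨t, ht, by simp; positivity⟩
  rwa [mlC_ofReal, Complex.norm_real, Real.norm_eq_abs] at this

lemma ml_real_rec {α : ℝ} (hα0 : 0 < α) (b t : ℝ) :
    ∑' k : ℕ, t ^ k / Real.Gamma (k * α + b) = (Real.Gamma b)⁻¹ +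
      t * ∑' k : ℕ, t ^ k / Real.Gamma (k * α + (b + α)) := by
  have := mlC_rec hα0 b t
  rw [mlC_ofReal, mlC_ofReal] at this
  exact_mod_cast this

lemma ml_expand {α : ℝ} (hα0 : 0 < α) (β : ℝ) {t : ℝ} (ht : t ≠ 0) (p : ℕ) :
    mittagLeffler α β t + ∑ k ∈ Finset.Icc 1 p, t ^ (-(k : ℤ)) / Real.Gamma (β - α * k) =
      t ^ (-(p : ℤ)) * mittagLeffler α (β - α * p) t := by
  induction p with
  | zero => simp
  | succ p ih =>
    rw [Finset.sum_Icc_succ_top (by omega), ← add_assoc, ih]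
    have h := ml_real_rec hα0 (β - α * (p + 1 : ℕ)) t
    rw [show β - α * ((p + 1 : ℕ) : ℝ) + α = β - α * p by push_cast; ring] at h
    have h1 : t ^ (-(p : ℤ)) = t ^ (-((p + 1 : ℕ) : ℤ)) * t := by
      rw [← zpow_add_one₀ ht]; congr 1; push_cast; ring
    rw [h1]
    unfold mittagLeffler
    rw [h]
    ring

theorem mittagLeffler_asymptotic (α β : ℝ) (hα0 : 0 < α) (hα2 : α < 2)
    (p : ℕ) (hp : 0 < p) :
    ∃ C > 0, ∃ t₀ > 0, ∀ t : ℝ, t₀ ≤ t →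
      |mittagLeffler α β (-t) +
          ∑ k ∈ Finset.Icc 1 p, (-t) ^ (-(k : ℤ)) / Real.Gamma (β - α * k)|
        ≤ C * t ^ (-1 - (p : ℤ)) := by
  obtain ⟨C, hC⟩ := ml_real_bound hα0 hα2 (β - α * (p + 1 : ℕ))
  set D := |(Real.Gamma (β - α * (p + 1 : ℕ)))⁻¹| with hD
  refine ⟨|C| + D + 1, by positivity, 1, one_pos, fun t ht => ?_⟩
  have ht0 : 0 < t := by linarith
  have hne : -t ≠ 0 := by linarith
  have h := ml_expand hα0 β hne (p + 1)
  rw [Finset.sum_Icc_succ_top (by omega), ← add_assoc] at h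
  have h2 := eq_sub_of_add_eq h
  rw [h2, div_eq_mul_inv, ← mul_sub, abs_mul, abs_zpow, abs_neg, abs_of_pos ht0, mul_comm,
    show -((p + 1 : ℕ) : ℤ) = -1 - (p : ℤ) by push_cast; ring]
  gcongr
  refine (abs_sub _ _).trans ?_
  have := (hC t ht0).trans (le_abs_self C)
  unfold mittagLeffler
  linarith
end

section
/- Let 0 < α < 1. Then the function t ↦ E_{α,1}(−t) is completely monotonic on (0,∞); that is, it is infinitely differentiable on (0,∞) and (−1)^n (d^n/dt^n) E_{α,1}(−t) ≥ 0 for every nonnegative integer n and every t > 0. -/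
open Filter Topology

/-- Coefficients of the formal derivative. -/
def coefD (c : ℕ → ℝ) : ℕ → ℝ := fun k => ((k : ℝ) + 1) * c (k + 1)

/-- Sum of the power series. -/
noncomputable def psum (c : ℕ → ℝ) (x : ℝ) : ℝ := ∑' k, c k * x ^ k

theorem psum_hasDerivAt (c : ℕ → ℝ) (C ρ x : ℝ) (hρ : 0 < ρ) (hx : |x| < ρ)
    (hc : ∀ k, |c k| * ρ ^ k ≤ C) : HasDerivAt (psum c) (psum (coefD c) x) x := by
  obtain ⟨r, hxr, hr⟩ := exists_between hx
  have hr0 : 0 < r := lt_of_le_of_lt (abs_nonneg x) hxr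
  have hq1 : ‖r / ρ‖ < 1 := by
    rw [Real.norm_of_nonneg (by positivity)]; exact (div_lt_one hρ).2 hr
  have hu : Summable (fun k : ℕ => C / r * ((k : ℝ) ^ 1 * (r / ρ) ^ k)) :=
    (summable_pow_mul_geometric_of_norm_lt_one 1 hq1).mul_left _
  have hbd : ∀ (k : ℕ) (y : ℝ), y ∈ Metric.ball (0 : ℝ) r →
      ‖c k * ((k : ℝ) * y ^ (k - 1))‖ ≤ C / r * ((k : ℝ) ^ 1 * (r / ρ) ^ k) := by
    intro k y hy
    have hy' : |y| < r := by simpa using hy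
    rcases k with _ | k
    · simp
    · have h1 : |y| ^ k ≤ r ^ k := pow_le_pow_left₀ (abs_nonneg y) hy'.le k
      have e : C / r * (((k + 1 : ℕ) : ℝ) ^ 1 * (r / ρ) ^ (k + 1))
          = (C / ρ ^ (k + 1)) * (((k + 1 : ℕ) : ℝ) * r ^ k) := by
        rw [div_pow]
        field_simp
        ring
      rw [e, norm_mul, norm_mul, norm_pow, Real.norm_eq_abs, Real.norm_eq_abs, Real.norm_eq_abs,
        Nat.abs_cast]
      have h2 : |c (k + 1)| ≤ C / ρ ^ (k + 1) := by
        rw [le_div_iff₀ (by positivity)]; exact hc _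
      simp only [Nat.add_sub_cancel]
      gcongr
      exact le_trans (abs_nonneg _) h2
  have hxm : x ∈ Metric.ball (0 : ℝ) r := by simpa using hxr
  have key := hasDerivAt_tsum_of_isPreconnected (g := fun k y => c k * y ^ k)
    (g' := fun k y => c k * ((k : ℝ) * y ^ (k - 1))) (y₀ := 0) (y := x) hu
    Metric.isOpen_ball (convex_ball (0 : ℝ) r).isPreconnected
    (fun k y _ => (hasDerivAt_pow k y).const_mul (c k)) hbd
    (Metric.mem_ball_self hr0)
    (by
      apply summable_of_ne_finset_zero (s := {0})
      intro k hk
      have : k ≠ 0 := by simpa using hk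
      simp [this]) hxm
  have hs : Summable (fun k => c k * ((k : ℝ) * x ^ (k - 1))) :=
    Summable.of_norm_bounded hu (fun k => hbd k x hxm)
  have e : ∑' k, c k * ((k : ℝ) * x ^ (k - 1)) = psum (coefD c) x := by
    rw [hs.tsum_eq_zero_add]
    simp only [psum, coefD]
    simp only [Nat.cast_zero, zero_mul, mul_zero, zero_add, Nat.add_sub_cancel]
    congr 1; ext k; push_cast; ring
  rw [← e]
  exact key

theorem coefD_bound (c : ℕ → ℝ) (C ρ : ℝ) (hρ : 0 < ρ) (hc : ∀ k, |c k| * (2 * ρ) ^ k ≤ C) (k : ℕ) :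
    |coefD c k| * ρ ^ k ≤ C / ρ := by
  have h := hc (k + 1)
  have h2 : ((k : ℝ) + 1) ≤ 2 ^ (k + 1) := by
    have : k + 1 < 2 ^ (k + 1) := Nat.lt_two_pow_self
    exact_mod_cast this.le
  rw [le_div_iff₀ hρ, coefD, abs_mul, abs_of_nonneg (by positivity : (0 : ℝ) ≤ (k : ℝ) + 1)]
  calc _ = ((k : ℝ) + 1) * (|c (k + 1)| * ρ ^ (k + 1)) := by ring
    _ ≤ 2 ^ (k + 1) * (|c (k + 1)| * ρ ^ (k + 1)) := by gcongr
    _ = |c (k + 1)| * (2 * ρ) ^ (k + 1) := by ring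
    _ ≤ C := h

/-- Coefficientwise convergence with uniform bounds. -/
def GoodFam (a : ℕ → ℕ → ℝ) (c : ℕ → ℝ) : Prop :=
  (∀ k, Tendsto (fun n => a n k) atTop (𝓝 (c k))) ∧
  ∀ ρ : ℝ, 0 < ρ → ∃ C : ℝ, ∃ N : ℕ, ∀ n ≥ N, ∀ k, |a n k| * ρ ^ k ≤ C

theorem GoodFam.D {a : ℕ → ℕ → ℝ} {c : ℕ → ℝ} (h : GoodFam a c) :
    GoodFam (fun n => coefD (a n)) (coefD c) := by
  refine ⟨fun k => (h.1 (k + 1)).const_mul _, fun ρ hρ => ?_⟩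
  obtain ⟨C, N, hC⟩ := h.2 (2 * ρ) (by positivity)
  exact ⟨C / ρ, N, fun n hn k => coefD_bound _ _ _ hρ (hC n hn) k⟩

theorem GoodFam.lim_bound {a : ℕ → ℕ → ℝ} {c : ℕ → ℝ} (h : GoodFam a c) (ρ : ℝ) (hρ : 0 < ρ) :
    ∃ C : ℝ, ∀ k, |c k| * ρ ^ k ≤ C := by
  obtain ⟨C, N, hC⟩ := h.2 ρ hρ
  refine ⟨C, fun k => ?_⟩
  refine le_of_tendsto ((h.1 k).abs.mul_const _) ?_
  filter_upwards [eventually_ge_atTop N] with n hn using hC n hn k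

theorem GoodFam.hasDerivAt {a : ℕ → ℕ → ℝ} {c : ℕ → ℝ} (h : GoodFam a c) (x : ℝ) :
    HasDerivAt (psum c) (psum (coefD c) x) x := by
  obtain ⟨C, hC⟩ := h.lim_bound (|x| + 1) (by positivity)
  exact psum_hasDerivAt c C (|x| + 1) x (by positivity) (by linarith) hC

theorem GoodFam.tendsto {a : ℕ → ℕ → ℝ} {c : ℕ → ℝ} (h : GoodFam a c) (x : ℝ) :
    Tendsto (fun n => psum (a n) x) atTop (𝓝 (psum c x)) := by
  obtain ⟨C, N, hC⟩ := h.2 (2 * (|x| + 1)) (by positivity)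
  unfold psum
  refine tendsto_tsum_of_dominated_convergence (bound := fun k => C * (1 / 2) ^ k)
    ((summable_geometric_two).mul_left C) (fun k => (h.1 k).mul_const _) ?_
  filter_upwards [eventually_ge_atTop N] with n hn k
  have h1 := hC n hn k
  rw [norm_mul, norm_pow, Real.norm_eq_abs, Real.norm_eq_abs]
  have h2 : |x| ^ k ≤ (|x| + 1) ^ k := pow_le_pow_left₀ (abs_nonneg _) (by linarith) k
  calc |a n k| * |x| ^ k ≤ |a n k| * (|x| + 1) ^ k := by gcongr
    _ = (|a n k| * (2 * (|x| + 1)) ^ k) * (1 / 2) ^ k := by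
        rw [mul_assoc, ← mul_pow]; congr 2; ring
    _ ≤ C * (1 / 2) ^ k := by gcongr

/-- On `(0,δ)` the power series is, up to sign, a nonnegative combination of `(1+εx)⁻ʲ`. -/
def IsComb (ε δ : ℝ) (m : ℕ) (c : ℕ → ℝ) : Prop :=
  ∃ (N : ℕ) (p : ℕ → ℝ), (∀ j, 0 ≤ p j) ∧ ∀ x, 0 < x → x < δ →
    psum c x = (-1) ^ m * ∑ j ∈ Finset.range N, p j * ((1 + ε * x) ^ j)⁻¹

theorem IsComb.D {ε δ : ℝ} {m : ℕ} {c : ℕ → ℝ} (hε : 0 ≤ ε) (h : IsComb ε δ m c)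
    (hd : ∀ x, 0 < x → x < δ → HasDerivAt (psum c) (psum (coefD c) x) x) :
    IsComb ε δ (m + 1) (coefD c) := by
  obtain ⟨N, p, hp, hx⟩ := h
  refine ⟨N + 1, fun j => p (j - 1) * ((j - 1 : ℕ) : ℝ) * ε, fun j => by have := hp (j - 1); positivity, ?_⟩
  intro x h0 h1
  have hpos : 0 < 1 + ε * x := by positivity
  have hterm : ∀ j ∈ Finset.range N, HasDerivAt (fun y : ℝ => p j * ((1 + ε * y) ^ j)⁻¹)
      (-(p j * (j : ℝ) * ε * ((1 + ε * x) ^ (j + 1))⁻¹)) x := by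
    intro j _
    have h2 : HasDerivAt (fun y : ℝ => 1 + ε * y) ε x := by
      simpa using ((hasDerivAt_id x).const_mul ε).const_add 1
    have h3 := ((h2.pow j).inv (by simpa using (pow_pos hpos j).ne')).const_mul (p j)
    refine h3.congr_deriv ?_
    rcases j with _ | j
    · simp
    · simp only [Nat.add_sub_cancel, Pi.pow_apply]
      field_simp
      ring
  have hs := (HasDerivAt.fun_sum hterm).const_mul ((-1 : ℝ) ^ m)
  have heq : psum c =ᶠ[𝓝 x] fun y => (-1) ^ m * ∑ j ∈ Finset.range N, p j * ((1 + ε * y) ^ j)⁻¹ := by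
    filter_upwards [Ioo_mem_nhds h0 h1] with y hy using hx y hy.1 hy.2
  rw [(hd x h0 h1).unique (hs.congr_of_eventuallyEq heq), Finset.sum_range_succ', pow_succ]
  simp [Finset.sum_neg_distrib]

/-- The polynomial `∏_{i=1}^n (1+s/i)`. -/
noncomputable def qpoly (n : ℕ) (s : ℝ) : ℝ := ∏ i ∈ Finset.range n, (1 + s / ((i : ℝ) + 1))

theorem qpoly_pos (n : ℕ) (s : ℝ) (hs : 0 ≤ s) : 0 < qpoly n s :=
  Finset.prod_pos fun i _ => by positivity

theorem qpoly_comb (α : ℝ) (h0 : 0 < α) (h1 : α < 1) (n : ℕ) :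
    ∃ p : ℕ → ℝ, (∀ j, 0 ≤ p j) ∧ ∀ k : ℕ, qpoly n (k * α) =
      ∑ j ∈ Finset.range (n + 1), p j * ((k + j).choose j : ℝ) := by
  induction n with
  | zero => exact ⟨fun _ => 1, fun _ => zero_le_one, fun k => by simp [qpoly]⟩
  | succ n ih =>
    obtain ⟨p, hp, hq⟩ := ih
    let A : ℕ → ℝ := fun j => if j = 0 then 0 else p (j - 1) * (α * j / (n + 1))
    let B : ℕ → ℝ := fun j => if j < n + 1 then p j * (1 - α * (j + 1) / (n + 1)) else 0
    refine ⟨fun j => A j + B j, fun j => ?_, fun k => ?_⟩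
    · have hA : 0 ≤ A j := by
        simp only [A]; split_ifs
        · exact le_rfl
        · have := hp (j - 1); positivity
      have hB : 0 ≤ B j := by
        simp only [B]; split_ifs with hj
        · refine mul_nonneg (hp j) ?_
          have hj' : (j : ℝ) + 1 ≤ n + 1 := by exact_mod_cast hj
          rw [sub_nonneg, div_le_one (by positivity)]
          nlinarith
        · exact le_rfl
      exact add_nonneg hA hB
    · have hch : ∀ j : ℕ, (k : ℝ) * ((k + j).choose j : ℝ) =
          ((j : ℝ) + 1) * (((k + (j + 1)).choose (j + 1) : ℝ) - ((k + j).choose j : ℝ)) := by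
        intro j
        have := Nat.add_one_mul_choose_eq (k + j) j
        have h' : ((k : ℝ) + j + 1) * ((k + j).choose j : ℝ)
            = ((k + (j + 1)).choose (j + 1) : ℝ) * (j + 1) := by exact_mod_cast this
        linear_combination h'
      have hstep : qpoly (n + 1) (k * α) = qpoly n (k * α) * (1 + k * α / (n + 1)) := by
        simp [qpoly, Finset.prod_range_succ]
      rw [hstep, hq k]
      simp only [add_mul, Finset.sum_add_distrib]
      rw [Finset.sum_range_succ' (fun j => A j * _), Finset.sum_range_succ (fun j => B j * _)]
      have hA : ∑ j ∈ Finset.range (n + 1), A (j + 1) * ((k + (j + 1)).choose (j + 1) : ℝ)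
          = ∑ j ∈ Finset.range (n + 1), p j * (α * (j + 1) / (n + 1)) * ((k + (j + 1)).choose (j + 1) : ℝ) := by
        refine Finset.sum_congr rfl fun j _ => ?_
        simp [A]
      have hB : ∑ j ∈ Finset.range (n + 1), B j * ((k + j).choose j : ℝ)
          = ∑ j ∈ Finset.range (n + 1), p j * (1 - α * (j + 1) / (n + 1)) * ((k + j).choose j : ℝ) := by
        refine Finset.sum_congr rfl fun j hj => ?_
        have : j < n + 1 := by simpa using hj
        simp only [B, if_pos this]
      have hA0 : A 0 = 0 := by simp [A]
      have hBn : B (n + 1) = 0 := by simp [B]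
      rw [hA, hB, hA0, hBn, zero_mul, zero_mul, add_zero, add_zero, ← Finset.sum_add_distrib,
        Finset.sum_mul]
      refine Finset.sum_congr rfl fun j _ => ?_
      linear_combination p j * α / (n + 1) * hch j

/-- Coefficients of the approximants. -/
noncomputable def apx (α : ℝ) (n k : ℕ) : ℝ := (-1) ^ k * (qpoly n (k * α) * (((n : ℝ) ^ α)⁻¹) ^ k)

theorem apx_isComb (α : ℝ) (h0 : 0 < α) (h1 : α < 1) (n : ℕ) (hn : 1 ≤ n) :
    IsComb (((n : ℝ) ^ α)⁻¹) ((n : ℝ) ^ α) 0 (apx α n) := by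
  obtain ⟨p, hp, hq⟩ := qpoly_comb α h0 h1 n
  have hn' : (0 : ℝ) < n := by exact_mod_cast hn
  have hna : 0 < (n : ℝ) ^ α := Real.rpow_pos_of_pos hn' α
  refine ⟨n + 2, fun j => if j = 0 then 0 else p (j - 1), fun j => ?_, fun x hx0 hx1 => ?_⟩
  · dsimp only; split_ifs
    · exact le_rfl
    · exact hp _
  · set l := ((n : ℝ) ^ α)⁻¹ * x with hl
    have hl0 : 0 < l := by positivity
    have hl1 : l < 1 := by
      rw [hl, inv_mul_lt_iff₀ hna]; simpa using hx1
    have hnorm : ‖-l‖ < 1 := by rw [norm_neg, Real.norm_of_nonneg hl0.le]; exact hl1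
    have hsum : ∀ j ∈ Finset.range (n + 1), HasSum (fun k : ℕ => p j * (((k + j).choose j : ℝ) * (-l) ^ k))
        (p j * (1 / (1 - -l) ^ (j + 1))) := fun j _ =>
      (hasSum_choose_mul_geometric_of_norm_lt_one j hnorm).mul_left _
    have hs := hasSum_sum hsum
    have e : psum (apx α n) x = ∑ j ∈ Finset.range (n + 1), p j * (1 / (1 - -l) ^ (j + 1)) := by
      rw [← hs.tsum_eq, psum]
      congr 1; ext k
      rw [apx, hq k, hl, neg_pow (_ * x), mul_pow, Finset.sum_mul, Finset.mul_sum, Finset.sum_mul]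
      refine Finset.sum_congr rfl fun j _ => ?_
      ring
    rw [e, Finset.sum_range_succ' _ (n + 1)]
    simp

theorem qpoly_ratio (M : ℕ) (hM : 1 ≤ M) (s : ℝ) (hs : 0 ≤ s) (n : ℕ) (hn : M ≤ n) :
    qpoly n s * ((n : ℝ) ^ s)⁻¹ ≤ qpoly M s * ((M : ℝ) ^ s)⁻¹ := by
  induction n, hn using Nat.le_induction with
  | base => exact le_rfl
  | succ n hn ih =>
    refine le_trans ?_ ih
    have hn0 : (0 : ℝ) < n := by exact_mod_cast (lt_of_lt_of_le hM hn)
    have hstep : qpoly (n + 1) s = qpoly n s * (1 + s / (n + 1)) := by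
      simp [qpoly, Finset.prod_range_succ]
    have hk : (1 + s / ((n : ℝ) + 1)) ≤ (((n : ℝ) + 1) / n) ^ s := by
      have hl := Real.one_sub_inv_le_log_of_pos (x := ((n : ℝ) + 1) / n) (by positivity)
      have e : 1 - (((n : ℝ) + 1) / n)⁻¹ = 1 / ((n : ℝ) + 1) := by field_simp; ring
      rw [e] at hl
      rw [Real.rpow_def_of_pos (by positivity)]
      have := Real.add_one_le_exp (Real.log (((n : ℝ) + 1) / n) * s)
      have h3 : 1 / ((n : ℝ) + 1) * s ≤ Real.log (((n : ℝ) + 1) / n) * s := by gcongr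
      have h4 : 1 / ((n : ℝ) + 1) * s = s / (n + 1) := by ring
      linarith
    rw [Real.div_rpow (by positivity) hn0.le] at hk
    have hq := qpoly_pos n s hs
    have hp1 : 0 < (n : ℝ) ^ s := Real.rpow_pos_of_pos hn0 s
    have hp2 : 0 < ((n : ℝ) + 1) ^ s := Real.rpow_pos_of_pos (by positivity) s
    rw [hstep]
    push_cast
    calc qpoly n s * (1 + s / (n + 1)) * (((n : ℝ) + 1) ^ s)⁻¹
        ≤ qpoly n s * (((n : ℝ) + 1) ^ s / (n : ℝ) ^ s) * (((n : ℝ) + 1) ^ s)⁻¹ := by gcongr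
      _ = qpoly n s * ((n : ℝ) ^ s)⁻¹ := by field_simp

theorem qpoly_le (n : ℕ) (s : ℝ) (hs : 0 ≤ s) : qpoly n s ≤ (1 + s) ^ n := by
  unfold qpoly
  calc _ ≤ ∏ i ∈ Finset.range n, (1 + s) := by
        refine Finset.prod_le_prod (fun i _ => by positivity) fun i _ => ?_
        have : s / ((i : ℝ) + 1) ≤ s := div_le_self hs (by linarith [(Nat.cast_nonneg i : (0 : ℝ) ≤ i)])
        linarith
    _ = _ := by simp

theorem rpow_k (n k : ℕ) (α : ℝ) : ((n : ℝ) ^ α) ^ k = (n : ℝ) ^ ((k : ℝ) * α) := by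
  rw [mul_comm, Real.rpow_mul (Nat.cast_nonneg n), Real.rpow_natCast]

theorem apx_good (α : ℝ) (h0 : 0 < α) (h1 : α < 1) :
    GoodFam (apx α) (fun k => (-1) ^ k / Real.Gamma (k * α + 1)) := by
  constructor
  · intro k
    simp only [apx, div_eq_mul_inv]
    refine Tendsto.const_mul _ ?_
    rcases Nat.eq_zero_or_pos k with rfl | hk
    · simp [qpoly]
    · set s : ℝ := k * α with hs
      have hs0 : 0 < s := by have : (0 : ℝ) < k := by exact_mod_cast hk
                             positivity
      have hG := (Real.GammaSeq_tendsto_Gamma s).const_mul s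
      rw [← Real.Gamma_add_one hs0.ne'] at hG
      have hG' := hG.inv₀ (Real.Gamma_pos_of_pos (by positivity)).ne'
      refine hG'.congr' ?_
      filter_upwards [eventually_ge_atTop 1] with n hn
      have hn0 : (0 : ℝ) < n := by exact_mod_cast hn
      have hpw : 0 < (n : ℝ) ^ s := Real.rpow_pos_of_pos hn0 s
      rw [inv_pow, rpow_k, ← hs, Real.GammaSeq, Finset.prod_range_succ']
      have hf : ∏ i ∈ Finset.range n, (s + ((i + 1 : ℕ) : ℝ)) = qpoly n s * (n.factorial : ℝ) := by
        rw [qpoly, ← Finset.prod_range_add_one_eq_factorial, Nat.cast_prod, ← Finset.prod_mul_distrib]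
        refine Finset.prod_congr rfl fun i _ => ?_
        push_cast
        field_simp
        ring
      have hq := qpoly_pos n s hs0.le
      have hfac : (0 : ℝ) < n.factorial := by exact_mod_cast n.factorial_pos
      rw [hf]
      simp only [Nat.cast_zero, add_zero]
      field_simp
  · intro ρ hρ
    have ht : Tendsto (fun n : ℕ => (n : ℝ) ^ α) atTop atTop :=
      (tendsto_rpow_atTop h0).comp tendsto_natCast_atTop_atTop
    obtain ⟨M, hM, hM1⟩ := ((ht.eventually_ge_atTop (2 * ρ)).and (eventually_ge_atTop 1)).exists
    have hM0 : (0 : ℝ) < M := by exact_mod_cast hM1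
    have hMa : 0 < (M : ℝ) ^ α := Real.rpow_pos_of_pos hM0 α
    have hb : BddAbove (Set.range fun k : ℕ => ((k : ℝ) + 1) ^ M * (1 / 2) ^ (k + 1)) := by
      have h := tendsto_pow_const_mul_const_pow_of_abs_lt_one M (r := (1 / 2 : ℝ))
        (by rw [abs_of_pos] <;> norm_num)
      have h' := (tendsto_add_atTop_iff_nat 1).2 h
      have := h'.bddAbove_range
      simpa using this
    obtain ⟨B, hB⟩ := hb
    refine ⟨2 * B, M, fun n hn k => ?_⟩
    have hn0 : (0 : ℝ) < n := by exact_mod_cast lt_of_lt_of_le hM1 hn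
    have hs : 0 ≤ (k : ℝ) * α := by positivity
    have hB' : ((k : ℝ) + 1) ^ M * (1 / 2) ^ (k + 1) ≤ B := hB ⟨k, rfl⟩
    have hqn := qpoly_pos n _ hs
    have hqM := qpoly_pos M _ hs
    have hna : 0 < (n : ℝ) ^ α := Real.rpow_pos_of_pos hn0 α
    have habs : |apx α n k| = qpoly n (k * α) * ((n : ℝ) ^ ((k : ℝ) * α))⁻¹ := by
      rw [apx, abs_mul, abs_pow, abs_neg, abs_one, one_pow, one_mul, abs_of_pos (by positivity),
        inv_pow, rpow_k]
    rw [habs]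
    have hhalf : ρ / (M : ℝ) ^ α ≤ 1 / 2 := by
      rw [div_le_div_iff₀ hMa two_pos]; linarith
    calc _ ≤ (qpoly M (k * α) * ((M : ℝ) ^ ((k : ℝ) * α))⁻¹) * ρ ^ k := by
          gcongr ?_ * _
          exact qpoly_ratio M hM1 _ hs n hn
      _ = qpoly M (k * α) * (ρ / (M : ℝ) ^ α) ^ k := by
          rw [← rpow_k, div_pow]; field_simp
      _ ≤ ((k : ℝ) + 1) ^ M * (1 / 2) ^ k := by
          gcongr
          refine (qpoly_le M _ hs).trans ?_
          gcongr ?_ ^ _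
          have : (k : ℝ) * α ≤ k := mul_le_of_le_one_right (Nat.cast_nonneg k) h1.le
          linarith
      _ = 2 * (((k : ℝ) + 1) ^ M * (1 / 2) ^ (k + 1)) := by ring
      _ ≤ 2 * B := by linarith

theorem iter_good {a : ℕ → ℕ → ℝ} {c : ℕ → ℝ} (h : GoodFam a c) (m : ℕ) :
    GoodFam (fun n => coefD^[m] (a n)) (coefD^[m] c) := by
  induction m with
  | zero => exact h
  | succ m ih => simpa only [Function.iterate_succ_apply'] using ih.D

theorem nonneg_iter (α : ℝ) (h0 : 0 < α) (h1 : α < 1) (m : ℕ) (t : ℝ) (ht : 0 < t) :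
    0 ≤ (-1 : ℝ) ^ m * psum (coefD^[m] (fun k => (-1) ^ k / Real.Gamma (k * α + 1))) t := by
  have hg := apx_good α h0 h1
  -- eventually, the approximants are combinations on (0, t+1)
  have hcomb : ∀ m : ℕ, ∀ᶠ n : ℕ in atTop,
      IsComb (((n : ℝ) ^ α)⁻¹) (t + 1) m (coefD^[m] (apx α n)) := by
    intro m
    induction m with
    | zero =>
      have htd : Tendsto (fun n : ℕ => (n : ℝ) ^ α) atTop atTop :=
        (tendsto_rpow_atTop h0).comp tendsto_natCast_atTop_atTop
      filter_upwards [htd.eventually_ge_atTop (t + 1), eventually_ge_atTop 1] with n hn hn1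
      obtain ⟨N, p, hp, hx⟩ := apx_isComb α h0 h1 n hn1
      exact ⟨N, p, hp, fun x hx0 hx1 => hx x hx0 (hx1.trans_le hn)⟩
    | succ m ih =>
      obtain ⟨C, N, hC⟩ := (iter_good hg m).2 (t + 1) (by positivity)
      filter_upwards [ih, eventually_ge_atTop N] with n hn hnN
      rw [Function.iterate_succ_apply']
      refine hn.D (by positivity) fun x hx0 hx1 => ?_
      exact psum_hasDerivAt _ C (t + 1) x (by positivity) (by rwa [abs_of_pos hx0]) (hC n hnN)
  refine ge_of_tendsto (((iter_good hg m).tendsto t).const_mul ((-1 : ℝ) ^ m)) ?_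
  filter_upwards [hcomb m] with n hn
  obtain ⟨N, p, hp, hx⟩ := hn
  rw [hx t ht (by linarith), ← mul_assoc, ← mul_pow]
  simp only [mul_neg, mul_one, neg_neg, one_pow, one_mul]
  exact Finset.sum_nonneg fun j _ => mul_nonneg (hp j) (by positivity)

theorem mittagLeffler_completelyMonotone_one (α : ℝ) (hα0 : 0 < α) (hα1 : α < 1) :
    ContDiffOn ℝ (⊤ : ℕ∞) (fun t : ℝ => mittagLeffler α 1 (-t)) (Set.Ioi 0) ∧
    ∀ (n : ℕ) (t : ℝ), 0 < t →
      0 ≤ (-1 : ℝ) ^ n *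
        iteratedDerivWithin n (fun t : ℝ => mittagLeffler α 1 (-t)) (Set.Ioi 0) t := by
  have hg := apx_good α hα0 hα1
  have hf : (fun t : ℝ => mittagLeffler α 1 (-t))
      = psum (fun k => (-1) ^ k / Real.Gamma (k * α + 1)) := by
    ext t
    simp only [mittagLeffler, psum]
    congr 1; ext k
    rw [neg_pow]; ring
  rw [hf]
  set c : ℕ → ℝ := fun k => (-1) ^ k / Real.Gamma (k * α + 1) with hc
  have hit : ∀ m : ℕ, Set.EqOn (iteratedDerivWithin m (psum c) (Set.Ioi 0))
      (psum (coefD^[m] c)) (Set.Ioi 0) := by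
    intro m
    induction m with
    | zero => intro x hx; simp
    | succ m ih =>
      intro x hx
      rw [iteratedDerivWithin_succ, derivWithin_congr ih (ih hx), Function.iterate_succ_apply']
      exact ((iter_good hg m).hasDerivAt x).hasDerivWithinAt.derivWithin
        (isOpen_Ioi.uniqueDiffWithinAt hx)
  constructor
  · refine contDiffOn_of_differentiableOn_deriv fun m _ => ?_
    refine DifferentiableOn.congr (f := psum (coefD^[m] c)) ?_ (hit m)
    exact fun x _ => ((iter_good hg m).hasDerivAt x).differentiableAt.differentiableWithinAt
  · intro n t ht
    rw [hit n ht]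
    exact nonneg_iter α hα0 hα1 n t ht
end

section
/- Let 0 < α < 1. Then the function t ↦ E_{α,α}(−t) is completely monotonic on (0,∞); that is, it is infinitely differentiable on (0,∞) and (−1)^n (d^n/dt^n) E_{α,α}(−t) ≥ 0 for every nonnegative integer n and every t > 0. -/
open Filter Topology Finset

namespace MLProof

/-- Rising factorial. -/
noncomputable def rf (x : ℝ) (n : ℕ) : ℝ := ∏ i ∈ range n, (x + i)

lemma rf_succ (x : ℝ) (n : ℕ) : rf x (n + 1) = rf x n * (x + n) := by
  simp [rf, prod_range_succ]

lemma rf_pos {x : ℝ} (hx : 0 < x) (n : ℕ) : 0 < rf x n :=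
  prod_pos fun i _ => by positivity

lemma rf_nat (x n : ℕ) : rf (x : ℝ) n = (x.ascFactorial n : ℝ) := by
  rw [Nat.ascFactorial_eq_prod_range]; simp [rf]

/-- `(αx)^{(n)}` is a nonnegative combination of the `x^{(j)}`. -/
lemma exists_coeff {α : ℝ} (h0 : 0 < α) (h1 : α < 1) (n : ℕ) :
    ∃ c : ℕ → ℝ, (∀ j, 0 ≤ c j) ∧ (∀ j, n < j → c j = 0) ∧
      ∀ x, rf (α * x) n = ∑ j ∈ range (n + 1), c j * rf x j := by
  induction n with
  | zero =>
    refine ⟨fun j => if j = 0 then 1 else 0, fun j => by positivity, fun j hj => by simp; omega, ?_⟩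
    intro x; simp [rf]
  | succ n ih =>
    obtain ⟨c, hc, hz, hs⟩ := ih
    have hnn : ∀ j : ℕ, 0 ≤ (n - α * j) * c j := by
      intro j
      by_cases hj : n < j
      · simp [hz j hj]
      · have : (j : ℝ) ≤ n := by exact_mod_cast not_lt.mp hj
        have h3 : (0 : ℝ) ≤ j := by positivity
        exact mul_nonneg (by nlinarith) (hc j)
    refine ⟨fun j => (if j = 0 then 0 else α * c (j - 1)) + (n - α * j) * c j, ?_, ?_, ?_⟩
    · intro j
      have := hnn j
      have h2 := hc (j - 1)
      dsimp only
      split_ifs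
      · linarith
      · positivity
    · intro j hj
      have h2 : c (j - 1) = 0 := hz _ (by omega)
      have h3 : c j = 0 := hz _ (by omega)
      simp [h2, h3]
    · intro x
      rw [rf_succ, hs x]
      simp_rw [add_mul, sum_add_distrib]
      rw [sum_range_succ' (fun j => (if j = 0 then 0 else α * c (j - 1)) * rf x j)]
      rw [sum_range_succ (fun j : ℕ => (n - α * j) * c j * rf x j) (n + 1), hz (n + 1) (by omega)]
      simp only [Nat.add_sub_cancel, rf_succ, if_true, Nat.succ_ne_zero, if_false]
      rw [sum_mul, zero_mul, mul_zero, zero_mul, add_zero, add_zero, ← sum_add_distrib]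
      exact sum_congr rfl fun j _ => by ring

lemma hasSum_rf {x : ℝ} (hx : |x| < 1) (m : ℕ) :
    HasSum (fun k : ℕ => rf ((k : ℝ) + 1) m * x ^ k) (m.factorial * (1 / (1 - x) ^ (m + 1))) := by
  have := (hasSum_choose_mul_geometric_of_norm_lt_one m (r := x) (by simpa using hx)).mul_left
    (m.factorial : ℝ)
  refine this.congr_fun ?_ |> fun h => h
  intro k
  have h := rf_nat (k + 1) m
  rw [Nat.ascFactorial_eq_factorial_mul_choose] at h
  push_cast at h
  rw [h]; ring

lemma rf_mul (k m j : ℕ) :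
    rf ((k : ℝ) + 1) m * rf ((k : ℝ) + m + 1) j = rf ((k : ℝ) + 1) (m + j) := by
  have h1 := rf_nat (k + 1) m
  have h2 := rf_nat (k + 1 + m) j
  have h3 := rf_nat (k + 1) (m + j)
  have h4 := Nat.ascFactorial_mul_ascFactorial (k + 1) m j
  rw [← h4] at h3
  push_cast at h1 h2 h3
  rw [h3, h1, ← h2]
  congr 2; ring

lemma key_sum {α : ℝ} (h0 : 0 < α) (h1 : α < 1) (n m : ℕ) {x : ℝ} (hx : |x| < 1) :
    ∃ S, 0 ≤ S ∧
      HasSum (fun k : ℕ => rf ((k : ℝ) + 1) m * rf (α * ((k : ℝ) + m + 1)) n * x ^ k) S := by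
  obtain ⟨c, hc, -, hs⟩ := exists_coeff h0 h1 n
  have hx1 : 0 < 1 - x := by linarith [le_abs_self x]
  refine ⟨∑ j ∈ range (n + 1), c j * ((m + j).factorial * (1 / (1 - x) ^ (m + j + 1))),
    sum_nonneg fun j _ => mul_nonneg (hc j) (by positivity), ?_⟩
  have := hasSum_sum (s := range (n + 1)) fun j _ => (hasSum_rf hx (m + j)).mul_left (c j)
  refine this.congr_fun ?_ |> fun h => h
  intro k
  rw [hs, mul_sum, sum_mul]
  exact sum_congr rfl fun j _ => by rw [← rf_mul]; ring

/-- Euler approximations of `1 / Γ(s)`. -/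
noncomputable def b (n : ℕ) (s : ℝ) : ℝ := (n : ℝ) ^ (1 - s) * rf s n / n.factorial

lemma b_nonneg (n : ℕ) {s : ℝ} (hs : 0 < s) : 0 ≤ b n s := by
  have := (rf_pos hs n).le
  unfold b; positivity

lemma b_tendsto {s : ℝ} (hs : 0 < s) :
    Tendsto (fun n => b n s) atTop (𝓝 (1 / Real.Gamma s)) := by
  have h1 := (Real.GammaSeq_tendsto_Gamma s).inv₀ (Real.Gamma_pos_of_pos hs).ne'
  have h2 : Tendsto (fun n : ℕ => (n : ℝ) / (n + s)) atTop (𝓝 1) := by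
    exact tendsto_natCast_div_add_atTop s
  have h3 := h1.mul h2
  rw [mul_one, ← one_div] at h3
  refine h3.congr' ?_
  filter_upwards [eventually_gt_atTop 0] with n hn
  have hn' : (0 : ℝ) < n := by exact_mod_cast hn
  have e : ∏ j ∈ range (n + 1), (s + (j : ℝ)) = rf s n * (s + n) := rf_succ s n
  have hr := rf_pos hs n
  simp only [Real.GammaSeq, b, e]
  rw [Real.rpow_sub hn', Real.rpow_one]
  have : (0 : ℝ) < n ^ s := by positivity
  have h5 : (n : ℝ) + s ≠ 0 := by positivity
  have h6 : s + (n : ℝ) ≠ 0 := by positivity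
  field_simp
  ring

lemma b_succ {s : ℝ} {n : ℕ} (hn : 0 < n) :
    b (n + 1) s = (rf s n / n.factorial) * ((n : ℝ) ^ (1 - s)) *
      ((1 + s * (1 / n)) / (1 + 1 / (n : ℝ)) ^ s) := by
  have hn' : (0 : ℝ) < n := by exact_mod_cast hn
  have e : (1 + 1 / (n : ℝ)) = ((n + 1 : ℕ) : ℝ) / n := by push_cast; field_simp
  rw [e, Real.div_rpow (by positivity) (by positivity), b, rf_succ, Real.rpow_sub hn',
    Real.rpow_sub (by positivity), Nat.factorial_succ, Real.rpow_one, Real.rpow_one]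
  have h1 : (0 : ℝ) < (n : ℝ) ^ s := by positivity
  have h2 : (0 : ℝ) < ((n + 1 : ℕ) : ℝ) ^ s := by positivity
  push_cast at h2 ⊢
  field_simp
  ring

lemma b_eq (n : ℕ) (s : ℝ) : b n s = (rf s n / n.factorial) * ((n : ℝ) ^ (1 - s)) := by
  unfold b; ring

lemma b_anti {s : ℝ} (hs : 1 ≤ s) : AntitoneOn (fun n => b n s) {n | 1 ≤ n} := by
  refine antitoneOn_nat_Ici_of_succ_le fun n hn => ?_
  have hn' : (0 : ℝ) < n := by exact_mod_cast hn
  rw [b_succ hn, b_eq n]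
  have := rf_pos (by linarith : 0 < s) n
  refine mul_le_of_le_one_right (by positivity) ?_
  rw [div_le_one (by positivity)]
  exact one_add_mul_self_le_rpow_one_add (by linarith [show 0 < 1 / (n : ℝ) by positivity]) hs

lemma b_mono {s : ℝ} (hs0 : 0 < s) (hs : s ≤ 1) : MonotoneOn (fun n => b n s) {n | 1 ≤ n} := by
  refine monotoneOn_nat_Ici_of_le_succ fun n hn => ?_
  have hn' : (0 : ℝ) < n := by exact_mod_cast hn
  rw [b_succ hn, b_eq n]
  have := rf_pos hs0 n
  refine le_mul_of_one_le_right (by positivity) ?_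
  rw [one_le_div (by positivity)]
  exact rpow_one_add_le_one_add_mul_self
    (by linarith [show 0 < 1 / (n : ℝ) by positivity]) hs0.le hs

lemma inv_gamma_le {s : ℝ} (hs : 1 ≤ s) {N : ℕ} (hN : 1 ≤ N) : 1 / Real.Gamma s ≤ b N s := by
  refine le_of_tendsto (b_tendsto (by linarith)) ?_
  filter_upwards [eventually_ge_atTop N] with n hn
  exact b_anti hs hN (le_trans hN hn) hn

lemma b_le {s : ℝ} (hs : 0 < s) {N n : ℕ} (hN : 1 ≤ N) (hn : N ≤ n) :
    b n s ≤ b N s + 1 / Real.Gamma s := by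
  have hG := Real.Gamma_pos_of_pos hs
  have hb := b_nonneg N hs
  rcases le_total 1 s with h | h
  · have := b_anti h hN (le_trans hN hn) hn
    have h2 : 0 < 1 / Real.Gamma s := by positivity
    simp only at this
    linarith
  · have : b n s ≤ 1 / Real.Gamma s := by
      refine ge_of_tendsto (b_tendsto hs) ?_
      filter_upwards [eventually_ge_atTop n] with k hk
      exact b_mono hs h (le_trans hN hn) (le_trans (le_trans hN hn) hk) hk
    linarith

/-- The approximating series. -/
lemma approx_sum {α : ℝ} (h0 : 0 < α) (h1 : α < 1) (n m : ℕ) (hn : 1 ≤ n) {t : ℝ}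
    (hx : |t * (n : ℝ) ^ (-α)| < 1) :
    ∃ S, 0 ≤ S ∧
      HasSum (fun k : ℕ => rf ((k : ℝ) + 1) m * b n (α * ((k : ℝ) + m + 1)) * t ^ k) S := by
  obtain ⟨S, hS, h⟩ := key_sum h0 h1 n m hx
  have hn' : (0 : ℝ) < n := by exact_mod_cast hn
  refine ⟨((n : ℝ) ^ (1 - α * (m + 1)) / n.factorial) * S, by positivity, ?_⟩
  refine (h.mul_left ((n : ℝ) ^ (1 - α * (m + 1)) / n.factorial)).congr_fun ?_ |> fun h => h
  intro k
  have e : (n : ℝ) ^ (1 - α * ((k : ℝ) + m + 1)) =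
      (n : ℝ) ^ (1 - α * (m + 1)) * ((n : ℝ) ^ (-α)) ^ k := by
    rw [← Real.rpow_natCast, ← Real.rpow_mul hn'.le, ← Real.rpow_add hn']
    congr 1; ring
  rw [b, e, mul_pow]
  ring

lemma exists_N {α : ℝ} (h0 : 0 < α) (t : ℝ) :
    ∀ᶠ n : ℕ in atTop, 1 ≤ n ∧ |t * (n : ℝ) ^ (-α)| < 1 := by
  have h : Tendsto (fun n : ℕ => |t * (n : ℝ) ^ (-α)|) atTop (𝓝 0) := by
    have := ((tendsto_rpow_neg_atTop h0).comp tendsto_natCast_atTop_atTop).const_mul t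
    simpa using this.abs
  exact (eventually_ge_atTop 1).and (h.eventually_lt_const one_pos)

/-- Coefficients of the `m`-th derivative. -/
noncomputable def A (α : ℝ) (m k : ℕ) : ℝ :=
  rf ((k : ℝ) + 1) m * (1 / Real.Gamma (α * ((k : ℝ) + m + 1)))

lemma A_nonneg {α : ℝ} (h0 : 0 < α) (m k : ℕ) : 0 ≤ A α m k := by
  have := rf_pos (by positivity : 0 < (k : ℝ) + 1) m
  have := Real.Gamma_pos_of_pos (by positivity : 0 < α * ((k : ℝ) + m + 1))
  unfold A; positivity

lemma A_summable {α : ℝ} (h0 : 0 < α) (h1 : α < 1) (m : ℕ) {t : ℝ} (ht : 0 ≤ t) :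
    Summable (fun k => A α m k * t ^ k) := by
  obtain ⟨N, hN, hx⟩ := (exists_N h0 t).exists
  obtain ⟨S, -, hS⟩ := approx_sum h0 h1 N m hN hx
  refine hS.summable.of_norm_bounded_eventually_nat ?_
  filter_upwards [eventually_ge_atTop ⌈1 / α⌉₊] with k hk
  have hk' : 1 / α ≤ k := Nat.ceil_le.mp hk
  have hs : 1 ≤ α * ((k : ℝ) + m + 1) := by
    rw [div_le_iff₀ h0] at hk'
    have : 0 ≤ α * (m + 1) := by positivity
    linarith
  have hr := rf_pos (by positivity : 0 < (k : ℝ) + 1) m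
  rw [Real.norm_of_nonneg (mul_nonneg (A_nonneg h0 m k) (by positivity))]
  unfold A
  gcongr
  exact inv_gamma_le hs hN

/-- Values of the `m`-th derivative. -/
noncomputable def G (α : ℝ) (m : ℕ) (x : ℝ) : ℝ := ∑' k, A α m k * x ^ k

lemma G_nonneg {α : ℝ} (h0 : 0 < α) (h1 : α < 1) (m : ℕ) {t : ℝ} (ht : 0 ≤ t) :
    0 ≤ G α m (-t) := by
  obtain ⟨N, hN, hx⟩ := (exists_N h0 t).exists
  obtain ⟨S, -, hS⟩ := approx_sum h0 h1 N m hN hx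
  have hsum := hS.summable.add (A_summable h0 h1 m ht)
  have key := tendsto_tsum_of_dominated_convergence (𝓕 := atTop)
    (f := fun (n : ℕ) (k : ℕ) => rf ((k : ℝ) + 1) m * b n (α * ((k : ℝ) + m + 1)) * (-t) ^ k)
    (g := fun k : ℕ => A α m k * (-t) ^ k) hsum ?_ ?_
  · refine ge_of_tendsto key ?_
    filter_upwards [exists_N h0 (-t)] with n hn
    obtain ⟨S, hS0, hS⟩ := approx_sum h0 h1 n m hn.1 hn.2
    rw [hS.tsum_eq]; exact hS0
  · intro k
    exact ((b_tendsto (by positivity)).const_mul _).mul_const _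
  · filter_upwards [eventually_ge_atTop N] with n hn k
    have hr := rf_pos (by positivity : 0 < (k : ℝ) + 1) m
    have hs : 0 < α * ((k : ℝ) + m + 1) := by positivity
    rw [norm_mul, norm_pow, norm_neg, Real.norm_of_nonneg ht,
      Real.norm_of_nonneg (mul_nonneg hr.le (b_nonneg n hs)), A, ← add_mul, ← mul_add]
    gcongr
    exact b_le hs hN hn

lemma A_succ (α : ℝ) (m k : ℕ) : A α (m + 1) k = (k + 1) * A α m (k + 1) := by
  have h := rf_mul k 1 m
  have h1 : rf ((k : ℝ) + 1) 1 = k + 1 := by simp [rf]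
  rw [h1] at h
  unfold A
  rw [add_comm m 1, ← h]
  push_cast
  rw [show (k : ℝ) + (1 + m) + 1 = k + 1 + m + 1 by ring]
  ring

lemma G_hasDerivAt {α : ℝ} (h0 : 0 < α) (h1 : α < 1) (m : ℕ) (x : ℝ) :
    HasDerivAt (G α m) (G α (m + 1) x) x := by
  have hR : 0 ≤ |x| + 1 := by positivity
  have hsum1 := A_summable h0 h1 (m + 1) hR
  have hu : Summable (fun k : ℕ => A α m k * (k * (|x| + 1) ^ (k - 1))) := by
    rw [← summable_nat_add_iff 1]
    refine hsum1.congr fun k => ?_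
    rw [A_succ, Nat.add_sub_cancel]; push_cast; ring
  have hx : x ∈ Metric.ball (0 : ℝ) (|x| + 1) := by simp
  have := hasDerivAt_tsum_of_isPreconnected (u := fun k : ℕ => A α m k * (k * (|x| + 1) ^ (k - 1)))
    (g := fun k x => A α m k * x ^ k) (g' := fun (k : ℕ) x => A α m k * (k * x ^ (k - 1)))
    (y₀ := 0) (y := x) hu Metric.isOpen_ball (convex_ball (0 : ℝ) (|x| + 1)).isPreconnected
    (fun k y _ => (hasDerivAt_pow k y).const_mul _) ?_ (by simp; positivity)
    (A_summable h0 h1 m le_rfl) hx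
  · have hs : Summable (fun k : ℕ => A α m k * (k * x ^ (k - 1))) := by
      refine hu.of_norm_bounded fun k => ?_
      rw [norm_mul, norm_mul, norm_pow, Real.norm_of_nonneg (A_nonneg h0 m k)]
      have := A_nonneg h0 m k
      rw [Real.norm_natCast, Real.norm_eq_abs]
      gcongr
      linarith
    refine this.congr_deriv ?_
    rw [hs.tsum_eq_zero_add]
    simp only [Nat.cast_zero, zero_mul, mul_zero, zero_add, G]
    refine tsum_congr fun k => ?_
    rw [A_succ, Nat.add_sub_cancel]; push_cast; ring
  · intro k y hy
    rw [norm_mul, norm_mul, norm_pow, Real.norm_of_nonneg (A_nonneg h0 m k)]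
    have := A_nonneg h0 m k
    have hy' : |y| < |x| + 1 := by simpa using hy
    rw [Real.norm_natCast, Real.norm_eq_abs]
    gcongr

lemma ml_eq (α t : ℝ) : mittagLeffler α α (-t) = G α 0 (-t) := by
  unfold mittagLeffler G A
  refine tsum_congr fun k => ?_
  rw [show α * ((k : ℝ) + (0 : ℕ) + 1) = k * α + α by push_cast; ring]
  simp [rf]; ring

lemma iter {α : ℝ} (h0 : 0 < α) (h1 : α < 1) (n : ℕ) : ∀ t ∈ Set.Ioi (0 : ℝ),
    iteratedDerivWithin n (fun t : ℝ => mittagLeffler α α (-t)) (Set.Ioi 0) t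
      = (-1) ^ n * G α n (-t) := by
  induction n with
  | zero => intro t _; simp [ml_eq]
  | succ n ih =>
    intro t ht
    rw [iteratedDerivWithin_succ, derivWithin_congr ih (ih t ht)]
    have h := ((G_hasDerivAt h0 h1 n (-t)).scomp t (hasDerivAt_neg t)).const_mul ((-1 : ℝ) ^ n)
    have h' := h.hasDerivWithinAt.derivWithin (uniqueDiffOn_Ioi (0 : ℝ) t ht)
    refine Eq.trans h' ?_
    simp [pow_succ]

end MLProof

theorem mittagLeffler_completelyMonotone_alpha (α : ℝ) (hα0 : 0 < α) (hα1 : α < 1) :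
    ContDiffOn ℝ (⊤ : ℕ∞) (fun t : ℝ => mittagLeffler α α (-t)) (Set.Ioi 0) ∧
    ∀ (n : ℕ) (t : ℝ), 0 < t →
      0 ≤ (-1 : ℝ) ^ n *
        iteratedDerivWithin n (fun t : ℝ => mittagLeffler α α (-t)) (Set.Ioi 0) t := by
  constructor
  · refine contDiffOn_of_differentiableOn_deriv fun m _ => ?_
    refine DifferentiableOn.congr ?_ (MLProof.iter hα0 hα1 m)
    intro t _
    exact (((MLProof.G_hasDerivAt hα0 hα1 m (-t)).scomp t (hasDerivAt_neg t)).const_mul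
      ((-1 : ℝ) ^ m)).differentiableAt.differentiableWithinAt
  · intro n t ht
    rw [MLProof.iter hα0 hα1 n t ht, ← mul_assoc, ← mul_pow]
    simpa using MLProof.G_nonneg hα0 hα1 n ht.le
end

section
/- Let 1/2 < α < 1. Then there exists a constant C > 0, depending only on α, such that for every λ > 0 and every t > 0, ∫_0^t τ^{2α−2} [E_{α,α}(−λ τ^α)]² dτ ≤ C t^{2α−1}. -/
open MeasureTheory Set Filter Topology

theorem ml_gamma_ratio {α s : ℝ} (h0 : 0 < α) (h1 : α < 1) (hs : 0 < s) :
    s * Real.Gamma s ≤ Real.Gamma (s + α) * (s + α) ^ (1 - α) := by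
  have h := Real.Gamma_mul_add_mul_le_rpow_Gamma_mul_rpow_Gamma (s := s + α) (t := s + α + 1)
    (a := α) (b := 1 - α) (by linarith) (by linarith) h0 (by linarith) (by ring)
  have e : α * (s + α) + (1 - α) * (s + α + 1) = s + 1 := by ring
  have hp : 0 < s + α := by linarith
  have hG := Real.Gamma_pos_of_pos hp
  rw [e, Real.Gamma_add_one hs.ne', Real.Gamma_add_one hp.ne',
    Real.mul_rpow hp.le hG.le] at h
  calc _ ≤ _ := h
    _ = (Real.Gamma (s + α) ^ α * Real.Gamma (s + α) ^ (1 - α)) * (s + α) ^ (1 - α) := by ring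
    _ = _ := by rw [← Real.rpow_add hG]; simp

theorem ml_summable_s9 {α : ℝ} (h0 : 0 < α) (h1 : α < 1) (β : ℝ) (hβ : 0 < β) (x : ℝ) :
    Summable (fun k : ℕ => x ^ k / Real.Gamma (k * α + β)) := by
  by_cases hx : x = 0
  · refine summable_of_ne_finset_zero (s := {0}) ?_
    intro k hk
    simp at hk
    simp [hx, hk]
  have hpos : ∀ k : ℕ, 0 < (k : ℝ) * α + β := fun k => by positivity
  refine summable_of_ratio_test_tendsto_lt_one (l := 0) one_pos
    (Eventually.of_forall fun k => div_ne_zero (pow_ne_zero _ hx)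
      (Real.Gamma_pos_of_pos (hpos k)).ne') ?_
  have lim1 : Tendsto (fun k : ℕ => (k : ℝ) * α + β) atTop atTop :=
    tendsto_atTop_add_const_right _ _ (tendsto_natCast_atTop_atTop.atTop_mul_const h0)
  have lim2 : Tendsto (fun s : ℝ => |x| * (2 * (s + α) ^ (-α))) atTop (𝓝 0) := by
    have := (tendsto_rpow_neg_atTop h0).comp (tendsto_atTop_add_const_right atTop α tendsto_id)
    simpa using (this.const_mul 2).const_mul |x|
  refine squeeze_zero' (Eventually.of_forall fun k => by positivity) ?_ (lim2.comp lim1)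
  filter_upwards [lim1.eventually_ge_atTop α] with k hk
  have hs := hpos k
  have e : ((k + 1 : ℕ) : ℝ) * α + β = (k * α + β) + α := by push_cast; ring
  rw [e]
  simp only [Function.comp]
  set s := (k : ℝ) * α + β
  have hG := Real.Gamma_pos_of_pos hs
  have hG' := Real.Gamma_pos_of_pos (show 0 < s + α by linarith)
  have hr := ml_gamma_ratio h0 h1 hs
  rw [norm_div, norm_div, norm_pow, norm_pow, Real.norm_of_nonneg hG.le,
    Real.norm_of_nonneg hG'.le, Real.norm_eq_abs]
  have hx' : 0 < |x| := abs_pos.2 hx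
  have : |x| ^ (k + 1) / Real.Gamma (s + α) / (|x| ^ k / Real.Gamma s)
      = |x| * (Real.Gamma s / Real.Gamma (s + α)) := by
    rw [pow_succ]
    field_simp
  rw [this]
  gcongr
  rw [div_le_iff₀ hG']
  have hp : 0 < s + α := by linarith
  have e2 : (s + α) ^ (1 - α) = (s + α) * (s + α) ^ (-α) := by
    rw [sub_eq_add_neg, Real.rpow_add hp, Real.rpow_one]
  rw [e2] at hr
  have hq : 0 < (s + α) ^ (-α) := Real.rpow_pos_of_pos hp _
  have : s * Real.Gamma s ≤ s * (2 * (s + α) ^ (-α) * Real.Gamma (s + α)) := by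
    refine hr.trans ?_
    have : (s + α) ≤ 2 * s := by linarith
    calc _ = (s + α) * ((s + α) ^ (-α) * Real.Gamma (s + α)) := by ring
      _ ≤ (2 * s) * ((s + α) ^ (-α) * Real.Gamma (s + α)) := by gcongr
      _ = _ := by ring
  exact le_of_mul_le_mul_left this hs

theorem ml_abs_le {α : ℝ} (h0 : 0 < α) (h1 : α < 1) {x R : ℝ} (hx : |x| ≤ R) :
    |mittagLeffler α α x| ≤ mittagLeffler α α R := by
  unfold mittagLeffler
  have hG : ∀ k : ℕ, 0 < Real.Gamma (k * α + α) := fun k => Real.Gamma_pos_of_pos (by positivity)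
  rw [← Real.norm_eq_abs]
  refine tsum_of_norm_bounded (ml_summable_s9 h0 h1 α h0 R).hasSum ?_
  intro k
  rw [norm_div, norm_pow, Real.norm_of_nonneg (hG k).le, Real.norm_eq_abs]
  have := hG k
  gcongr

theorem ml_continuous {α : ℝ} (h0 : 0 < α) (h1 : α < 1) : Continuous (mittagLeffler α α) := by
  have hG : ∀ k : ℕ, 0 < Real.Gamma (k * α + α) := fun k => Real.Gamma_pos_of_pos (by positivity)
  rw [continuous_iff_continuousAt]
  intro x
  have : ContinuousOn (mittagLeffler α α) (Metric.ball 0 (|x| + 1)) := by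
    unfold mittagLeffler
    refine continuousOn_tsum (fun i => by fun_prop) (ml_summable_s9 h0 h1 α h0 (|x| + 1)) ?_
    intro k y hy
    simp at hy
    rw [norm_div, norm_pow, Real.norm_of_nonneg (hG k).le, Real.norm_eq_abs]
    have := hG k
    gcongr
  exact this.continuousAt (Metric.isOpen_ball.mem_nhds (by simp))

theorem ml_beta {u v t : ℝ} (hu : 0 < u) (hv : 0 < v) (ht : 0 < t) :
    ∫ s in Ioc 0 t, s ^ (u - 1) * (t - s) ^ (v - 1)
      = t ^ (u + v - 1) * (Real.Gamma u * Real.Gamma v / Real.Gamma (u + v)) := by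
  have h := Complex.betaIntegral_scaled (u : ℂ) (v : ℂ) ht
  rw [Complex.betaIntegral_eq_Gamma_mul_div _ _ (by simpa) (by simpa)] at h
  rw [← intervalIntegral.integral_of_le ht.le]
  have e : ∫ x in (0:ℝ)..t, (x : ℂ) ^ ((u : ℂ) - 1) * ((t : ℂ) - x) ^ ((v : ℂ) - 1)
      = ∫ x in (0:ℝ)..t, ((x ^ (u - 1) * (t - x) ^ (v - 1) : ℝ) : ℂ) := by
    refine intervalIntegral.integral_congr ?_
    intro x hx
    rw [uIcc_of_le ht.le] at hx
    simp only
    push_cast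
    rw [Complex.ofReal_cpow hx.1, Complex.ofReal_cpow (by linarith [hx.2])]
    push_cast
    rfl
  rw [e, intervalIntegral.integral_ofReal] at h
  have : ((t : ℂ) ^ ((u : ℂ) + v - 1)) = ((t ^ (u + v - 1) : ℝ) : ℂ) := by
    rw [Complex.ofReal_cpow ht.le]; push_cast; rfl
  rw [this, Complex.Gamma_ofReal, Complex.Gamma_ofReal, ← Complex.ofReal_add,
    Complex.Gamma_ofReal] at h
  exact_mod_cast h

theorem ml_beta_integrable {u v t : ℝ} (hu : 0 < u) (hv : 0 < v) (ht : 0 < t) :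
    Integrable (fun s => s ^ (u - 1) * (t - s) ^ (v - 1)) (volume.restrict (Ioc 0 t)) := by
  by_contra h
  have := ml_beta hu hv ht
  rw [integral_undef h] at this
  have h1 := Real.Gamma_pos_of_pos hu
  have h2 := Real.Gamma_pos_of_pos hv
  have h3 := Real.Gamma_pos_of_pos (add_pos hu hv)
  have : 0 < t ^ (u + v - 1) * (Real.Gamma u * Real.Gamma v / Real.Gamma (u + v)) := by positivity
  linarith

/-- Volterra equation. -/
theorem ml_volterra {α : ℝ} (h0 : 0 < α) (h1 : α < 1) (lam : ℝ) {t : ℝ} (ht : 0 < t) :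
    lam / Real.Gamma α * ∫ s in Ioc 0 t, (s ^ (α - 1) * mittagLeffler α α (-lam * s ^ α))
        * (t - s) ^ (α - 1)
      = t ^ (α - 1) / Real.Gamma α - t ^ (α - 1) * mittagLeffler α α (-lam * t ^ α) := by
  have hG : ∀ k : ℕ, 0 < Real.Gamma (k * α + α) := fun k => Real.Gamma_pos_of_pos (by positivity)
  have hGα := Real.Gamma_pos_of_pos h0
  let F : ℕ → ℝ → ℝ := fun k s =>
    ((-lam) ^ k / Real.Gamma (k * α + α)) * (s ^ ((k * α + α) - 1) * (t - s) ^ (α - 1))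
  have hFi : ∀ k, Integrable (F k) (volume.restrict (Ioc 0 t)) := fun k =>
    (ml_beta_integrable (by positivity) h0 ht).const_mul _
  have key : ∀ c : ℝ, ∀ k : ℕ, c ^ k / Real.Gamma (k * α + α) *
      (t ^ ((k * α + α) + α - 1) *
        (Real.Gamma (k * α + α) * Real.Gamma α / Real.Gamma ((k * α + α) + α)))
      = (Real.Gamma α * t ^ (α + α - 1)) *
        ((c * t ^ α) ^ k / Real.Gamma (k * α + (α + α))) := by
    intro c k
    have e1 : t ^ ((k * α + α) + α - 1) = (t ^ α) ^ k * t ^ (α + α - 1) := by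
      rw [← Real.rpow_natCast (t ^ α), ← Real.rpow_mul ht.le, ← Real.rpow_add ht]
      congr 1; ring
    rw [e1, mul_pow, add_assoc]
    have := (hG k).ne'
    field_simp
  have hFint : ∀ k, ∫ s in Ioc 0 t, F k s = (Real.Gamma α * t ^ (α + α - 1)) *
        ((-lam * t ^ α) ^ k / Real.Gamma (k * α + (α + α))) := by
    intro k
    rw [← key]
    simp only [F]
    rw [integral_const_mul, ml_beta (by positivity) h0 ht]
  have hFnorm : ∀ k, ∫ s in Ioc 0 t, ‖F k s‖ = (Real.Gamma α * t ^ (α + α - 1)) *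
        ((|lam| * t ^ α) ^ k / Real.Gamma (k * α + (α + α))) := by
    intro k
    rw [← key, ← ml_beta (by positivity) h0 ht, ← integral_const_mul]
    refine setIntegral_congr_fun measurableSet_Ioc ?_
    intro s hs
    simp only [F]
    have : 0 ≤ t - s := by linarith [hs.2]
    have := hs.1.le
    rw [norm_mul, norm_div, norm_pow, norm_neg, Real.norm_of_nonneg (hG k).le, Real.norm_eq_abs,
      Real.norm_of_nonneg (by positivity)]
  have hS := hasSum_integral_of_summable_integral_norm hFi (by
    simp_rw [hFnorm]
    exact (ml_summable_s9 h0 h1 _ (by positivity) _).mul_left _)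
  simp_rw [hFint] at hS
  have e : ∀ s ∈ Ioc 0 t, (∑' k, F k s) = (s ^ (α - 1) * mittagLeffler α α (-lam * s ^ α))
        * (t - s) ^ (α - 1) := by
    intro s hs
    unfold mittagLeffler
    rw [← tsum_mul_left, ← tsum_mul_right]
    refine tsum_congr fun k => ?_
    simp only [F]
    have e1 : s ^ ((k * α + α) - 1) = (s ^ α) ^ k * s ^ (α - 1) := by
      rw [← Real.rpow_natCast (s ^ α), ← Real.rpow_mul hs.1.le, ← Real.rpow_add hs.1]
      congr 1; ring
    rw [e1, mul_pow]
    ring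
  rw [← setIntegral_congr_fun measurableSet_Ioc e, ← hS.tsum_eq, tsum_mul_left]
  unfold mittagLeffler
  rw [(ml_summable_s9 h0 h1 α h0 (-lam * t ^ α)).tsum_eq_zero_add]
  have e2 : ∀ k : ℕ, (-lam * t ^ α) ^ (k + 1) / Real.Gamma (((k + 1 : ℕ) : ℝ) * α + α)
      = (-lam * t ^ α) * ((-lam * t ^ α) ^ k / Real.Gamma (k * α + (α + α))) := by
    intro k
    rw [show ((k + 1 : ℕ) : ℝ) * α + α = k * α + (α + α) by push_cast; ring]
    ring
  simp_rw [e2]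
  rw [tsum_mul_left]
  have e3 : t ^ (α + α - 1) = t ^ α * t ^ (α - 1) := by
    rw [← Real.rpow_add ht]; congr 1; ring
  rw [e3]
  simp
  field_simp
  ring

/-- One-sided power. -/
noncomputable def mlPhi (b x : ℝ) : ℝ := if 0 < x then x ^ (-b) else 0

theorem mlPhi_nonneg (b x : ℝ) : 0 ≤ mlPhi b x := by
  unfold mlPhi; split_ifs with h
  · positivity
  · rfl

theorem mlPhi_measurable (b : ℝ) : Measurable (mlPhi b) := by
  unfold mlPhi
  exact Measurable.ite measurableSet_Ioi (by fun_prop) (by fun_prop)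

theorem mlPhi_mul (b x : ℝ) {r : ℝ} (hr : 0 < r) : mlPhi b (r * x) = r ^ (-b) * mlPhi b x := by
  unfold mlPhi
  by_cases hx : 0 < x
  · rw [if_pos hx, if_pos (by positivity), Real.mul_rpow hr.le hx.le]
  · rw [if_neg hx, if_neg (by rw [mul_pos_iff_of_pos_left hr]; exact hx), mul_zero]

noncomputable def mlPsi (b w : ℝ) : ℝ := mlPhi b (1 + w) * mlPhi b w

theorem mlPsi_integrable {b : ℝ} (h1 : 1/2 < b) (h2 : b < 1) : Integrable (mlPsi b) := by
  have hm : Measurable (mlPsi b) :=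
    ((mlPhi_measurable b).comp (by fun_prop)).mul (mlPhi_measurable b)
  have hz : ∀ w ∉ Ioi (0:ℝ), mlPsi b w = 0 := by
    intro w hw
    simp only [mem_Ioi] at hw
    simp [mlPsi, mlPhi, hw]
  rw [← integrableOn_iff_integrable_of_support_subset (s := Ioi (0:ℝ))
    (fun w hw => by by_contra h; exact hw (hz w h)), ← Ioc_union_Ioi_eq_Ioi zero_le_one]
  refine IntegrableOn.union ?_ ?_
  · have hi : IntegrableOn (fun w : ℝ => w ^ (-b)) (Ioc 0 1) := by
      rw [← intervalIntegrable_iff_integrableOn_Ioc_of_le zero_le_one]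
      exact intervalIntegral.intervalIntegrable_rpow' (by linarith)
    refine Integrable.mono' hi hm.aestronglyMeasurable ?_
    refine (ae_restrict_iff' measurableSet_Ioc).2 (Eventually.of_forall fun w hw => ?_)
    have hw0 := hw.1
    rw [mlPsi, Real.norm_of_nonneg (mul_nonneg (mlPhi_nonneg _ _) (mlPhi_nonneg _ _))]
    simp only [mlPhi]
    rw [if_pos hw0, if_pos (by linarith)]
    refine mul_le_of_le_one_left (by positivity) ?_
    exact Real.rpow_le_one_of_one_le_of_nonpos (by linarith) (by linarith)
  · have hi : IntegrableOn (fun w : ℝ => w ^ (-(2*b))) (Ioi 1) :=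
      integrableOn_Ioi_rpow_of_lt (by linarith) one_pos
    refine Integrable.mono' hi hm.aestronglyMeasurable ?_
    refine (ae_restrict_iff' measurableSet_Ioi).2 (Eventually.of_forall fun w hw => ?_)
    have hw0 : 0 < w := lt_trans one_pos hw
    rw [mlPsi, Real.norm_of_nonneg (mul_nonneg (mlPhi_nonneg _ _) (mlPhi_nonneg _ _))]
    simp only [mlPhi]
    rw [if_pos hw0, if_pos (by linarith), show -(2*b) = -b + -b by ring, Real.rpow_add hw0]
    gcongr ?_ * _
    exact Real.rpow_le_rpow_of_nonpos hw0 (by linarith) (by linarith)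

theorem mlPsi_pos {b : ℝ} (h1 : 1/2 < b) (h2 : b < 1) : 0 < ∫ w, mlPsi b w := by
  rw [integral_pos_iff_support_of_nonneg (f := mlPsi b)
    (fun w => mul_nonneg (mlPhi_nonneg _ _) (mlPhi_nonneg _ _)) (mlPsi_integrable h1 h2)]
  have : Ioo (0:ℝ) 1 ⊆ Function.support (mlPsi b) := by
    intro w hw
    have h0 := hw.1
    have h3 : 0 < 1 + w := by linarith
    simp only [Function.mem_support, mlPsi, mlPhi, if_pos h0, if_pos h3]
    positivity
  refine lt_of_lt_of_le ?_ (measure_mono this)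
  simp

theorem mlPhi_kernel_aux {b : ℝ} (h1 : 1/2 < b) (h2 : b < 1) {t s : ℝ} (h : s < t) :
    Integrable (fun u => mlPhi b (t - u) * mlPhi b (s - u)) ∧
    ∫ u, mlPhi b (t - u) * mlPhi b (s - u) = (∫ w, mlPsi b w) * (t - s) ^ (1 - 2 * b) := by
  have hr : 0 < t - s := by linarith
  set r := t - s with hrdef
  have e : ∀ u, mlPhi b (t - u) * mlPhi b (s - u)
      = (r ^ (-b) * r ^ (-b)) * mlPsi b (r⁻¹ * (s - u)) := by
    intro u
    have a1 : t - u = r * (1 + r⁻¹ * (s - u)) := by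
      field_simp; rw [hrdef]; ring
    have a2 : s - u = r * (r⁻¹ * (s - u)) := by field_simp
    rw [a1, mlPhi_mul _ _ hr]
    nth_rewrite 2 [a2]
    rw [mlPhi_mul _ _ hr, mlPsi]; ring
  simp_rw [e]
  constructor
  · refine Integrable.const_mul ?_ _
    have := (mlPsi_integrable h1 h2).comp_mul_left' (R := r⁻¹) (by positivity)
    exact this.comp_sub_left s
  · rw [integral_const_mul, integral_sub_left_eq_self (fun x => mlPsi b (r⁻¹ * x)),
      Measure.integral_comp_mul_left]
    rw [inv_inv, abs_of_pos hr, smul_eq_mul, show 1 - 2 * b = -b + -b + 1 by ring,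
      Real.rpow_add hr, Real.rpow_add hr, Real.rpow_one]
    ring

theorem mlPhi_kernel {b : ℝ} (h1 : 1/2 < b) (h2 : b < 1) {t s : ℝ} (h : s ≠ t) :
    Integrable (fun u => mlPhi b (t - u) * mlPhi b (s - u)) ∧
    ∫ u, mlPhi b (t - u) * mlPhi b (s - u) = (∫ w, mlPsi b w) * |t - s| ^ (1 - 2 * b) := by
  rcases lt_or_gt_of_ne h with h | h
  · rw [abs_of_pos (by linarith)]
    exact mlPhi_kernel_aux h1 h2 h
  · rw [abs_of_neg (by linarith), neg_sub]
    simp_rw [mul_comm (mlPhi b (t - _))]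
    exact mlPhi_kernel_aux h1 h2 h

/-- Integrability of the quadratic form. -/
theorem ml_quad_integrable {α : ℝ} (h0 : 0 < α) {T : ℝ} {F : ℝ → ℝ}
    (hFm : AEStronglyMeasurable F) (hF2 : Integrable (fun t => F t ^ 2))
    (hFz : ∀ t ∉ Ioc 0 T, F t = 0) :
    Integrable (fun p : ℝ × ℝ => F p.1 * F p.2 * |p.1 - p.2| ^ (α - 1)) := by
  let k : ℝ → ℝ := (Icc (-T) T).indicator (fun r => |r| ^ (α - 1))
  have hk0 : ∀ r, 0 ≤ k r := fun r => indicator_nonneg (fun _ _ => by positivity) _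
  have hk : Integrable k := by
    rw [integrable_indicator_iff measurableSet_Icc]
    rcases le_or_gt 0 T with hT | hT
    · have a1 : IntervalIntegrable (fun r : ℝ => |r| ^ (α - 1)) volume 0 T := by
        refine (intervalIntegral.intervalIntegrable_rpow' (r := α - 1) (by linarith)).congr ?_
        intro x hx
        rw [uIoc_of_le hT] at hx
        simp only [abs_of_pos hx.1]
      have a2 : IntervalIntegrable (fun r : ℝ => |r| ^ (α - 1)) volume (-T) 0 := by
        rw [IntervalIntegrable.iff_comp_neg]
        simpa using a1.symm
      have := a2.trans a1
      rw [intervalIntegrable_iff_integrableOn_Ioc_of_le (by linarith)] at this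
      rwa [integrableOn_Icc_iff_integrableOn_Ioc]
    · rw [Icc_eq_empty (by linarith)]; simp
  have hI2 : Integrable (fun p : ℝ × ℝ => F p.2 ^ 2 * k (p.1 - p.2)) :=
    Integrable.convolution_integrand (ContinuousLinearMap.mul ℝ ℝ) hF2 hk
  have hkeven : ∀ r, k (-r) = k r := by
    intro r
    simp only [k, indicator, mem_Icc, abs_neg]
    congr 1
    apply propext; constructor <;> rintro ⟨_, _⟩ <;> constructor <;> linarith
  have hI1 : Integrable (fun p : ℝ × ℝ => F p.1 ^ 2 * k (p.1 - p.2)) := by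
    refine (hI2.swap).congr (Eventually.of_forall fun p => ?_)
    simp only [Function.comp, Prod.fst_swap, Prod.snd_swap]
    rw [← hkeven, neg_sub]
  have hm : AEStronglyMeasurable (fun p : ℝ × ℝ => F p.1 * F p.2 * |p.1 - p.2| ^ (α - 1)) := by
    refine (hFm.comp_fst.mul hFm.comp_snd).mul ?_
    apply Measurable.aestronglyMeasurable
    fun_prop
  refine Integrable.mono' (hI1.add hI2) hm (Eventually.of_forall fun p => ?_)
  simp only [Pi.add_apply]
  have hnn : 0 ≤ F p.1 ^ 2 * k (p.1 - p.2) + F p.2 ^ 2 * k (p.1 - p.2) := by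
    have := hk0 (p.1 - p.2)
    positivity
  by_cases c1 : p.1 ∈ Ioc 0 T
  · by_cases c2 : p.2 ∈ Ioc 0 T
    · have : k (p.1 - p.2) = |p.1 - p.2| ^ (α - 1) := by
        simp only [k]
        rw [indicator_of_mem]
        constructor <;> linarith [c1.1, c1.2, c2.1, c2.2]
      rw [← this, norm_mul, Real.norm_of_nonneg (hk0 _), ← add_mul]
      refine mul_le_mul_of_nonneg_right ?_ (hk0 _)
      rw [Real.norm_eq_abs, abs_le]
      constructor <;> nlinarith [sq_nonneg (F p.1 - F p.2), sq_nonneg (F p.1 + F p.2)]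
    · simpa [hFz _ c2] using hnn
  · simpa [hFz _ c1] using hnn

theorem ml_diag_null : ∀ᵐ p : ℝ × ℝ, p.2 ≠ p.1 := by
  rw [Measure.volume_eq_prod]
  have hms : MeasurableSet {p : ℝ × ℝ | p.2 ≠ p.1} :=
    (measurableSet_eq_fun measurable_snd measurable_fst).compl
  rw [Measure.ae_prod_iff_ae_ae hms]
  refine Eventually.of_forall fun x => ?_
  simp [ae_iff]

/-- Positivity of the quadratic form. -/
theorem ml_quad_nonneg {α : ℝ} (h0 : 0 < α) (h1 : α < 1) {T : ℝ} {F : ℝ → ℝ}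
    (hFm : AEStronglyMeasurable F) (hF2 : Integrable (fun t => F t ^ 2))
    (hFz : ∀ t ∉ Ioc 0 T, F t = 0) :
    0 ≤ ∫ p : ℝ × ℝ, F p.1 * F p.2 * |p.1 - p.2| ^ (α - 1) := by
  have hQ := ml_quad_integrable h0 hFm hF2 hFz
  set b := 1 - α / 2 with hb
  have hb1 : 1/2 < b := by linarith
  have hb2 : b < 1 := by linarith
  have hexp : 1 - 2 * b = α - 1 := by rw [hb]; ring
  have hc := mlPsi_pos hb1 hb2
  set c := ∫ w, mlPsi b w
  let G : (ℝ × ℝ) × ℝ → ℝ := fun q =>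
    (F q.1.1 * mlPhi b (q.1.1 - q.2)) * (F q.1.2 * mlPhi b (q.1.2 - q.2))
  have hGe : ∀ q, G q = (F q.1.1 * F q.1.2) *
      (mlPhi b (q.1.1 - q.2) * mlPhi b (q.1.2 - q.2)) := fun q => by simp only [G]; ring
  have hm : AEStronglyMeasurable G ((volume : Measure (ℝ × ℝ)).prod (volume : Measure ℝ)) := by
    have a1 : AEStronglyMeasurable (fun p : ℝ × ℝ => F p.1 * F p.2) :=
      hFm.comp_fst.mul hFm.comp_snd
    have a2 : Measurable (fun q : (ℝ × ℝ) × ℝ =>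
        (mlPhi b (q.1.1 - q.2) * mlPhi b (q.1.2 - q.2))) :=
      ((mlPhi_measurable b).comp (by fun_prop)).mul ((mlPhi_measurable b).comp (by fun_prop))
    rw [show G = _ from funext hGe]
    exact (a1.comp_fst).mul a2.aestronglyMeasurable
  have hinner : ∀ᵐ p : ℝ × ℝ, ∫ u, G (p, u) = c * (F p.1 * F p.2 * |p.1 - p.2| ^ (α - 1)) := by
    filter_upwards [ml_diag_null] with p hp
    simp_rw [hGe]
    rw [integral_const_mul, (mlPhi_kernel hb1 hb2 hp).2, hexp]; ring
  have hGi : Integrable G ((volume : Measure (ℝ × ℝ)).prod (volume : Measure ℝ)) := by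
    rw [integrable_prod_iff hm]
    constructor
    · filter_upwards [ml_diag_null] with p hp
      simp_rw [hGe]
      exact (mlPhi_kernel hb1 hb2 hp).1.const_mul _
    · refine (hQ.norm.const_mul c).congr ?_
      filter_upwards [ml_diag_null] with p hp
      simp_rw [hGe, norm_mul (F p.1 * F p.2)]
      rw [integral_const_mul]
      have : ∀ u, ‖mlPhi b (p.1 - u) * mlPhi b (p.2 - u)‖
          = mlPhi b (p.1 - u) * mlPhi b (p.2 - u) := fun u =>
        Real.norm_of_nonneg (mul_nonneg (mlPhi_nonneg _ _) (mlPhi_nonneg _ _))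
      simp_rw [this]
      rw [(mlPhi_kernel hb1 hb2 hp).2, hexp,
        Real.norm_of_nonneg (by positivity : 0 ≤ |p.1 - p.2| ^ (α - 1))]
      ring
  have h3 : 0 ≤ ∫ p : ℝ × ℝ, ∫ u, G (p, u) := by
    rw [integral_integral_swap (f := fun p u => G (p, u)) hGi]
    refine integral_nonneg fun u => ?_
    simp only [G]
    rw [Measure.volume_eq_prod,
      integral_prod_mul (fun t => F t * mlPhi b (t - u)) (fun t => F t * mlPhi b (t - u))]
    exact mul_self_nonneg _
  rw [integral_congr_ae hinner, integral_const_mul] at h3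
  exact nonneg_of_mul_nonneg_right h3 hc

/-- One-sided version. -/
theorem ml_energy {α : ℝ} (h0 : 0 < α) (h1 : α < 1) {T : ℝ} {F : ℝ → ℝ}
    (hFm : AEStronglyMeasurable F) (hF2 : Integrable (fun t => F t ^ 2))
    (hFz : ∀ t ∉ Ioc 0 T, F t = 0) :
    Integrable (fun t => F t * ∫ s in Ioc 0 t, F s * (t - s) ^ (α - 1)) ∧
    0 ≤ ∫ t, F t * ∫ s in Ioc 0 t, F s * (t - s) ^ (α - 1) := by
  have hQ := ml_quad_integrable h0 hFm hF2 hFz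
  have hN := ml_quad_nonneg h0 h1 hFm hF2 hFz
  let Q : ℝ × ℝ → ℝ := fun p => F p.1 * F p.2 * |p.1 - p.2| ^ (α - 1)
  let S : Set (ℝ × ℝ) := {p | p.2 < p.1}
  have hS : MeasurableSet S := measurableSet_lt measurable_snd measurable_fst
  let A := S.indicator Q
  have hA : Integrable A := hQ.indicator hS
  have hA' : Integrable (fun p : ℝ × ℝ => A p.swap) := hA.swap
  have hsum : ∀ p, Q p = A p + A p.swap := by
    intro p
    rcases lt_trichotomy p.2 p.1 with h | h | h
    · simp [A, S, indicator, h, h.le, not_lt.2 h.le]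
    · have : α - 1 ≠ 0 := by linarith
      simp [A, S, indicator, h, Q, Real.zero_rpow this]
    · simp only [A, S, indicator, Q, mem_ofPred_eq, Prod.fst_swap, Prod.snd_swap, if_pos h,
        if_neg (not_lt.2 h.le), abs_sub_comm p.2 p.1]
      ring
  have hint : ∫ p, Q p = 2 * ∫ p, A p := by
    simp_rw [hsum]
    rw [integral_add hA hA', Measure.volume_eq_prod, integral_prod_swap]; ring
  have e : ∀ t, ∫ s, A (t, s) = F t * ∫ s in Ioc 0 t, F s * (t - s) ^ (α - 1) := by
    intro t
    rw [← integral_indicator measurableSet_Ioc, ← integral_const_mul]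
    refine integral_congr_ae (Eventually.of_forall fun s => ?_)
    simp only [A, S, Q, indicator, mem_ofPred_eq, mem_Ioc]
    by_cases hs : 0 < s
    · rcases lt_trichotomy s t with h | h | h
      · rw [if_pos h, if_pos ⟨hs, h.le⟩, abs_of_pos (by linarith)]; ring
      · have : α - 1 ≠ 0 := by linarith
        simp [h, Real.zero_rpow this]
      · rw [if_neg (not_lt.2 h.le), if_neg (fun hh => absurd hh.2 (not_le.2 h))]; ring
    · have : F s = 0 := hFz s (fun h => hs h.1)
      simp [this]
  rw [Measure.volume_eq_prod] at hA
  constructor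
  · have := hA.integral_prod_left
    exact this.congr (Eventually.of_forall e)
  · have := integral_prod _ hA
    simp_rw [e] at this
    rw [← this, ← Measure.volume_eq_prod]
    have h4 : 0 ≤ ∫ p, Q p := hN
    linarith

theorem mittagLeffler_square_integral_upper (α : ℝ) (hα0 : 1/2 < α) (hα1 : α < 1) :
    ∃ C > 0, ∀ lam > (0:ℝ), ∀ t > (0:ℝ),
      (∫ τ in (0:ℝ)..t, τ ^ (2*α - 2) * (mittagLeffler α α (-lam * τ ^ α)) ^ 2)
        ≤ C * t ^ (2*α - 1) := by
  have h0 : 0 < α := by linarith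
  have hG := Real.Gamma_pos_of_pos h0
  have h21 : 0 < 2 * α - 1 := by linarith
  refine ⟨1 / (Real.Gamma α ^ 2 * (2 * α - 1)), by positivity, ?_⟩
  intro lam hlam T hT
  let f : ℝ → ℝ := fun s => s ^ (α - 1) * mittagLeffler α α (-lam * s ^ α)
  let g : ℝ → ℝ := fun s => s ^ (α - 1) / Real.Gamma α
  let F := (Ioc 0 T).indicator f
  have hsq : ∀ s ∈ Ioc 0 T, (s ^ (α - 1)) ^ 2 = s ^ (2 * α - 2) := by
    intro s hs
    rw [← Real.rpow_natCast, ← Real.rpow_mul hs.1.le]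
    congr 1; push_cast; ring
  have hfm : Measurable f := by
    have := (ml_continuous h0 hα1).measurable
    have h2 : Measurable (fun s : ℝ => mittagLeffler α α (-lam * s ^ α)) :=
      this.comp (by fun_prop)
    exact (by fun_prop : Measurable (fun s : ℝ => s ^ (α - 1))).mul h2
  have hgm : Measurable g := by fun_prop
  have hpow : IntegrableOn (fun s : ℝ => s ^ (2 * α - 2)) (Ioc 0 T) := by
    rw [← intervalIntegrable_iff_integrableOn_Ioc_of_le hT.le]
    exact intervalIntegral.intervalIntegrable_rpow' (by linarith)
  set M := mittagLeffler α α (lam * T ^ α)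
  have hfM : ∀ s ∈ Ioc 0 T, f s ^ 2 ≤ M ^ 2 * s ^ (2 * α - 2) := by
    intro s hs
    have hs0 := hs.1
    have : |mittagLeffler α α (-lam * s ^ α)| ≤ M := by
      refine ml_abs_le h0 hα1 ?_
      rw [abs_mul, abs_neg, abs_of_pos hlam, abs_of_nonneg (by positivity)]
      have := hs.2
      gcongr
    simp only [f]
    rw [mul_pow, hsq s hs, mul_comm, ← sq_abs (mittagLeffler _ _ _)]
    gcongr
  have hf2 : IntegrableOn (fun s => f s ^ 2) (Ioc 0 T) := by
    refine Integrable.mono' (hpow.const_mul (M ^ 2)) (hfm.pow_const 2).aestronglyMeasurable ?_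
    refine (ae_restrict_iff' measurableSet_Ioc).2 (Eventually.of_forall fun s hs => ?_)
    rw [Real.norm_of_nonneg (by positivity)]
    exact hfM s hs
  have hgval : ∀ s ∈ Ioc 0 T, g s ^ 2 = 1 / Real.Gamma α ^ 2 * s ^ (2 * α - 2) := by
    intro s hs
    simp only [g]
    rw [div_pow, hsq s hs]; ring
  have hg2 : IntegrableOn (fun s => g s ^ 2) (Ioc 0 T) :=
    IntegrableOn.congr_fun (hpow.const_mul (1 / Real.Gamma α ^ 2))
      (fun s hs => (hgval s hs).symm) measurableSet_Ioc
  have hFz : ∀ t ∉ Ioc 0 T, F t = 0 := fun t ht => indicator_of_notMem ht _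
  have hFf : ∀ t ∈ Ioc 0 T, F t = f t := fun t ht => indicator_of_mem ht _
  have hFm : Measurable F := hfm.indicator measurableSet_Ioc
  have hF2 : Integrable (fun t => F t ^ 2) := by
    refine ((integrable_indicator_iff measurableSet_Ioc).2 hf2).congr
      (Eventually.of_forall fun s => ?_)
    by_cases hs : s ∈ Ioc 0 T
    · simp only [hFf s hs, indicator_of_mem hs]
    · simp [hFz s hs, indicator_of_notMem hs]
  obtain ⟨hEi, hE⟩ := ml_energy h0 hα1 hFm.aestronglyMeasurable hF2 hFz
  have hconv : ∀ t ∈ Ioc 0 T, F t * ∫ s in Ioc 0 t, F s * (t - s) ^ (α - 1)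
      = Real.Gamma α / lam * (f t * (g t - f t)) := by
    intro t ht
    have hv := ml_volterra h0 hα1 lam ht.1
    have : ∫ s in Ioc 0 t, F s * (t - s) ^ (α - 1)
        = ∫ s in Ioc 0 t, (s ^ (α - 1) * mittagLeffler α α (-lam * s ^ α)) * (t - s) ^ (α - 1) := by
      refine setIntegral_congr_fun measurableSet_Ioc fun s hs => ?_
      rw [hFf s ⟨hs.1, hs.2.trans ht.2⟩]
    rw [this, hFf t ht]
    have hv2 : g t - f t = lam / Real.Gamma α * ∫ s in Ioc 0 t,
        (s ^ (α - 1) * mittagLeffler α α (-lam * s ^ α)) * (t - s) ^ (α - 1) := hv.symm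
    rw [hv2]
    field_simp
  have hE2 : 0 ≤ ∫ t in Ioc 0 T, Real.Gamma α / lam * (f t * (g t - f t)) := by
    rw [← setIntegral_congr_fun measurableSet_Ioc hconv,
      setIntegral_eq_integral_of_forall_compl_eq_zero (fun t ht => by simp [hFz t ht])]
    exact hE
  have hEi2 : IntegrableOn (fun t => f t * (g t - f t)) (Ioc 0 T) := by
    have := (IntegrableOn.congr_fun hEi.integrableOn hconv measurableSet_Ioc).const_mul
      (lam / Real.Gamma α)
    refine this.congr (Eventually.of_forall fun t => ?_)
    simp only
    field_simp
  rw [integral_const_mul] at hE2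
  have hE3 : 0 ≤ ∫ t in Ioc 0 T, f t * (g t - f t) :=
    nonneg_of_mul_nonneg_right hE2 (by positivity)
  -- compare squares
  have hcmp : ∫ t in Ioc 0 T, (f t ^ 2 + 2 * (f t * (g t - f t))) ≤ ∫ t in Ioc 0 T, g t ^ 2 := by
    refine integral_mono (hf2.add (hEi2.const_mul 2)) hg2 fun t => ?_
    simp only
    nlinarith [sq_nonneg (f t - g t)]
  rw [integral_add hf2 (hEi2.const_mul 2), integral_const_mul] at hcmp
  have hgI : ∫ t in Ioc 0 T, g t ^ 2 = 1 / (Real.Gamma α ^ 2 * (2 * α - 1)) * T ^ (2 * α - 1) := by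
    rw [setIntegral_congr_fun measurableSet_Ioc hgval, integral_const_mul,
      ← intervalIntegral.integral_of_le hT.le, integral_rpow (Or.inl (by linarith)),
      show 2 * α - 2 + 1 = 2 * α - 1 by ring, Real.zero_rpow h21.ne']
    field_simp
    ring
  rw [intervalIntegral.integral_of_le hT.le, ← hgI]
  have hfI : ∫ τ in Ioc 0 T, τ ^ (2*α - 2) * (mittagLeffler α α (-lam * τ ^ α)) ^ 2
      = ∫ t in Ioc 0 T, f t ^ 2 := by
    refine setIntegral_congr_fun measurableSet_Ioc fun s hs => ?_
    simp only [f]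
    rw [mul_pow, hsq s hs]
  rw [hfI]
  linarith
end
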